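/- arXiv:math/9811014 — 2 statements merged into one kernel-verified Lean document; each statement's English description precedes it below -/
import Mathlib

section
/- Let 2n ≥ 6 and let Q be a positive definite quadratic form on ℝ^{2n}. For every ε > 0 there exists a C^∞ function h : ℝ^{2n} → ℝ such that h = Q outside some compact set, |h(x) − Q(x)| ≤ ε for all x, the value 1 is a regular value of h, and the Hamiltonian flow of h has no closed trajectories on the level set {h = 1}: there is no nonconstant periodic curve γ : ℝ → ℝ^{2n} with γ'(t) = i∇h(γ(t)) and h(γ(t)) = 1 for all t. -/
open scoped RealInnerProductSpace

/-- The hypersurface profile of a plug, as a function of the variables `(A, N, t, r)`. -/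
structure IsPlugProfile (δ τ η M : ℝ) (F : ℝ × ℝ × ℝ × ℝ → ℝ) : Prop where
  contDiff : ContDiff ℝ (⊤ : ℕ∞) F
  support : ∀ A N t r, F (A, N, t, r) ≠ 0 → |N| ≤ η / 2 ∧ |t| ≤ 3 / 4 * τ ∧ |r| ≤ δ / 2
  abs_le : ∀ A N t r, |A| ≤ M → |F (A, N, t, r)| ≤ δ
  odd : ∀ A N t r, F (A, N, -t, -r) = -F (A, N, t, r)
  speed_nonneg : ∀ A N t r, |A| ≤ M → 0 ≤ 1 + fderiv ℝ F (A, N, t, r) (0, 0, 0, 1)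
  core_of_speed_eq_zero : ∀ A N t r, |A| ≤ M → 1 + fderiv ℝ F (A, N, t, r) (0, 0, 0, 1) = 0 →
    N = 0 ∧ (t = τ / 2 ∨ t = -(τ / 2)) ∧ r = 0
  speed_core : 1 + fderiv ℝ F (0, 0, -(τ / 2), 0) (0, 0, 0, 1) = 0
  fderiv_t_core : fderiv ℝ F (0, 0, -(τ / 2), 0) (0, 0, 1, 0) = 0
  fderiv_A_core : ∀ t, (t = τ / 2 ∨ t = -(τ / 2)) → fderiv ℝ F (0, 0, t, 0) (1, 0, 0, 0) ≠ 0
  eq_zero_of_level : ∀ t r, r + F (0, 0, t, r) = 0 → r = 0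

namespace PlugProfile

open Real

/-- An even bump function attaining its maximum `1` only at the origin. -/
noncomputable def peak (x : ℝ) : ℝ := smoothTransition (1 - 4 * x ^ 2)

/-- An even bump function equal to `1` near the origin. -/
noncomputable def plateau (x : ℝ) : ℝ := smoothTransition (2 - 16 * x ^ 2)

/-- An even bump function attaining its maximum `1` exactly at `± 1 / 2`. -/
noncomputable def twinPeaks (x : ℝ) : ℝ := smoothTransition (1 - 16 * (x ^ 2 - 1 / 4) ^ 2)

lemma contDiff_smoothTransition_comp {f : ℝ → ℝ} (hf : ContDiff ℝ (⊤ : ℕ∞) f) :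
    ContDiff ℝ (⊤ : ℕ∞) fun x => smoothTransition (f x) :=
  (smoothTransition.contDiff (n := ⊤)).comp hf

@[fun_prop]
lemma contDiff_peak : ContDiff ℝ (⊤ : ℕ∞) peak :=
  contDiff_smoothTransition_comp (by fun_prop)

@[fun_prop]
lemma contDiff_plateau : ContDiff ℝ (⊤ : ℕ∞) plateau :=
  contDiff_smoothTransition_comp (by fun_prop)

@[fun_prop]
lemma contDiff_twinPeaks : ContDiff ℝ (⊤ : ℕ∞) twinPeaks :=
  contDiff_smoothTransition_comp (by fun_prop)

lemma peak_nonneg (x : ℝ) : 0 ≤ peak x := smoothTransition.nonneg _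
lemma peak_le_one (x : ℝ) : peak x ≤ 1 := smoothTransition.le_one _
lemma plateau_nonneg (x : ℝ) : 0 ≤ plateau x := smoothTransition.nonneg _
lemma plateau_le_one (x : ℝ) : plateau x ≤ 1 := smoothTransition.le_one _
lemma twinPeaks_nonneg (x : ℝ) : 0 ≤ twinPeaks x := smoothTransition.nonneg _
lemma twinPeaks_le_one (x : ℝ) : twinPeaks x ≤ 1 := smoothTransition.le_one _

lemma peak_zero : peak 0 = 1 := by simp [peak]
lemma plateau_zero : plateau 0 = 1 := smoothTransition.one_of_one_le (by norm_num)

lemma eq_zero_of_peak_eq_one {x : ℝ} (h : peak x = 1) : x = 0 := by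
  rw [peak, smoothTransition.eq_one_iff_one_le] at h
  nlinarith

lemma eq_of_twinPeaks_eq_one {x : ℝ} (h : twinPeaks x = 1) : x = 1 / 2 ∨ x = -(1 / 2) := by
  rw [twinPeaks, smoothTransition.eq_one_iff_one_le] at h
  have h1 : (x - 1 / 2) * (x + 1 / 2) = 0 := by
    have : (x ^ 2 - 1 / 4) ^ 2 = 0 := le_antisymm (by linarith) (sq_nonneg _)
    have := pow_eq_zero_iff (two_ne_zero) |>.1 this
    linarith
  rcases mul_eq_zero.1 h1 with h1 | h1
  · left; linarith
  · right; linarith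

lemma twinPeaks_of_eq {x : ℝ} (h : x = 1 / 2 ∨ x = -(1 / 2)) : twinPeaks x = 1 := by
  apply smoothTransition.one_of_one_le
  rcases h with rfl | rfl <;> norm_num

lemma peak_neg (x : ℝ) : peak (-x) = peak x := by simp [peak]
lemma plateau_neg (x : ℝ) : plateau (-x) = plateau x := by simp [plateau]
lemma twinPeaks_neg (x : ℝ) : twinPeaks (-x) = twinPeaks x := by simp [twinPeaks]

lemma abs_le_of_peak_ne_zero {x : ℝ} (h : peak x ≠ 0) : |x| ≤ 1 / 2 := by
  rw [peak, Ne, smoothTransition.zero_iff_nonpos, not_le] at h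
  exact abs_le_of_sq_le_sq (by linarith) (by norm_num)

lemma abs_le_of_plateau_ne_zero {x : ℝ} (h : plateau x ≠ 0) : |x| ≤ 1 / 2 := by
  rw [plateau, Ne, smoothTransition.zero_iff_nonpos, not_le] at h
  exact abs_le_of_sq_le_sq (by linarith) (by norm_num)

lemma abs_le_of_twinPeaks_ne_zero {x : ℝ} (h : twinPeaks x ≠ 0) : |x| ≤ 3 / 4 := by
  rw [twinPeaks, Ne, smoothTransition.zero_iff_nonpos, not_le] at h
  refine abs_le_of_sq_le_sq ?_ (by norm_num)
  nlinarith

lemma mul_deriv_peak_nonpos (x : ℝ) : x * deriv peak x ≤ 0 := by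
  have h1 : HasDerivAt (fun y : ℝ => 1 - 4 * y ^ 2) (-(8 * x)) x := by
    exact (((hasDerivAt_pow 2 x).const_mul 4).const_sub 1).congr_deriv (by push_cast; ring)
  have h2 : HasDerivAt smoothTransition (deriv smoothTransition (1 - 4 * x ^ 2)) (1 - 4 * x ^ 2) :=
    ((smoothTransition.contDiff (n := 1)).differentiable (by norm_num)).differentiableAt.hasDerivAt
  have h3 : deriv peak x = deriv smoothTransition (1 - 4 * x ^ 2) * (-(8 * x)) :=
    (h2.comp x h1).deriv
  have h4 : 0 ≤ deriv smoothTransition (1 - 4 * x ^ 2) := smoothTransition.monotone.deriv_nonneg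
  rw [h3]
  nlinarith [mul_nonneg h4 (sq_nonneg x)]

lemma deriv_plateau_eq_zero {x : ℝ} (h : x ^ 2 < 1 / 16) : deriv plateau x = 0 := by
  have : plateau =ᶠ[nhds x] fun _ => 1 := by
    have : ∀ᶠ y in nhds x, y ^ 2 < 1 / 16 :=
      (isOpen_lt (by fun_prop) continuous_const).mem_nhds h
    filter_upwards [this] with y hy
    exact smoothTransition.one_of_one_le (by linarith)
  rw [this.deriv_eq, deriv_const]

lemma peak_le_of_sq_ge {x : ℝ} (h : 1 / 16 ≤ x ^ 2) : peak x ≤ smoothTransition (3 / 4) :=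
  smoothTransition.monotone (by linarith)

lemma exists_bound_deriv_plateau : ∃ D, 0 ≤ D ∧ ∀ x, |deriv plateau x| ≤ D := by
  have hc : HasCompactSupport plateau := by
    refine HasCompactSupport.intro (isCompact_Icc (a := (-(1 / 2) : ℝ)) (b := 1 / 2)) ?_
    intro x hx
    by_contra h
    exact hx (abs_le.1 (abs_le_of_plateau_ne_zero h))
  obtain ⟨D, hD⟩ := (hc.deriv).exists_bound_of_continuous
    (contDiff_plateau.continuous_deriv (by norm_num))
  exact ⟨D, (norm_nonneg _).trans (hD 0), hD⟩

/-- The explicit plug profile. -/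
noncomputable def profile (δ τ η κ : ℝ) (p : ℝ × ℝ × ℝ × ℝ) : ℝ :=
  κ * p.1 * peak (p.2.1 / η) * (p.2.2.1 / τ * twinPeaks (p.2.2.1 / τ)) * plateau (p.2.2.2 / δ)
    - p.2.2.2 * peak (p.2.2.2 / δ) * twinPeaks (p.2.2.1 / τ) * peak (p.2.1 / η)

variable {δ τ η κ : ℝ}

lemma contDiff_profile : ContDiff ℝ (⊤ : ℕ∞) (profile δ τ η κ) := by
  unfold profile
  have h1 : ∀ c : ℝ, ContDiff ℝ (⊤ : ℕ∞) (fun x => peak (x / c)) := fun c =>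
    contDiff_peak.comp (by fun_prop)
  have h2 : ∀ c : ℝ, ContDiff ℝ (⊤ : ℕ∞) (fun x => plateau (x / c)) := fun c =>
    contDiff_plateau.comp (by fun_prop)
  have h3 : ∀ c : ℝ, ContDiff ℝ (⊤ : ℕ∞) (fun x => twinPeaks (x / c)) := fun c =>
    contDiff_twinPeaks.comp (by fun_prop)
  have e1 : ContDiff ℝ (⊤ : ℕ∞) (fun p : ℝ × ℝ × ℝ × ℝ => peak (p.2.1 / η)) :=
    (h1 η).comp (g := fun x => peak (x / η)) (f := fun p : ℝ × ℝ × ℝ × ℝ => p.2.1) (by fun_prop)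
  have e2 : ContDiff ℝ (⊤ : ℕ∞) (fun p : ℝ × ℝ × ℝ × ℝ => twinPeaks (p.2.2.1 / τ)) :=
    (h3 τ).comp (g := fun x => twinPeaks (x / τ)) (f := fun p : ℝ × ℝ × ℝ × ℝ => p.2.2.1)
      (by fun_prop)
  have e3 : ContDiff ℝ (⊤ : ℕ∞) (fun p : ℝ × ℝ × ℝ × ℝ => plateau (p.2.2.2 / δ)) :=
    (h2 δ).comp (g := fun x => plateau (x / δ)) (f := fun p : ℝ × ℝ × ℝ × ℝ => p.2.2.2)
      (by fun_prop)
  have e4 : ContDiff ℝ (⊤ : ℕ∞) (fun p : ℝ × ℝ × ℝ × ℝ => peak (p.2.2.2 / δ)) :=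
    (h1 δ).comp (g := fun x => peak (x / δ)) (f := fun p : ℝ × ℝ × ℝ × ℝ => p.2.2.2) (by fun_prop)
  fun_prop

lemma differentiable_profile : Differentiable ℝ (profile δ τ η κ) :=
  contDiff_profile.differentiable (by norm_num)

lemma fderiv_profile_r (A N t r : ℝ) :
    fderiv ℝ (profile δ τ η κ) (A, N, t, r) (0, 0, 0, 1) =
      κ * A * peak (N / η) * (t / τ * twinPeaks (t / τ)) * (deriv plateau (r / δ) / δ)
      - (peak (r / δ) + r / δ * deriv peak (r / δ)) * twinPeaks (t / τ) * peak (N / η) := by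
  have hl : HasDerivAt (fun s : ℝ => (A, N, t, s)) (0, 0, 0, 1) r :=
    (hasDerivAt_const _ _).prodMk ((hasDerivAt_const _ _).prodMk
      ((hasDerivAt_const _ _).prodMk (hasDerivAt_id _)))
  have h := (differentiable_profile (δ := δ) (τ := τ) (η := η) (κ := κ)
    (A, N, t, r)).hasFDerivAt.comp_hasDerivAt r hl
  refine h.unique ?_
  have hd : HasDerivAt (fun s : ℝ => s / δ) (1 / δ) r := (hasDerivAt_id r).div_const δ
  have hp : HasDerivAt (fun s => peak (s / δ)) (deriv peak (r / δ) * (1 / δ)) r :=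
    HasDerivAt.comp (h₂ := peak) r
      ((contDiff_peak.differentiable (by norm_num)) (r / δ)).hasDerivAt hd
  have hq : HasDerivAt (fun s => plateau (s / δ)) (deriv plateau (r / δ) * (1 / δ)) r :=
    HasDerivAt.comp (h₂ := plateau) r
      ((contDiff_plateau.differentiable (by norm_num)) (r / δ)).hasDerivAt hd
  have := (hq.const_mul (κ * A * peak (N / η) * (t / τ * twinPeaks (t / τ)))).sub
    ((((hasDerivAt_id r).mul hp).mul_const (twinPeaks (t / τ))).mul_const (peak (N / η)))
  exact this.congr_deriv (by simp only [id]; ring)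

lemma fderiv_profile_A (A N t r : ℝ) :
    fderiv ℝ (profile δ τ η κ) (A, N, t, r) (1, 0, 0, 0) =
      κ * peak (N / η) * (t / τ * twinPeaks (t / τ)) * plateau (r / δ) := by
  have hl : HasDerivAt (fun s : ℝ => (s, N, t, r)) (1, 0, 0, 0) A :=
    (hasDerivAt_id _).prodMk ((hasDerivAt_const _ _).prodMk
      ((hasDerivAt_const _ _).prodMk (hasDerivAt_const _ _)))
  have h := (differentiable_profile (δ := δ) (τ := τ) (η := η) (κ := κ)
    (A, N, t, r)).hasFDerivAt.comp_hasDerivAt A hl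
  refine h.unique ?_
  have := (((((hasDerivAt_id A).const_mul κ).mul_const (peak (N / η))).mul_const
    (t / τ * twinPeaks (t / τ))).mul_const (plateau (r / δ))).sub_const
    (r * peak (r / δ) * twinPeaks (t / τ) * peak (N / η))
  exact this.congr_deriv (by ring)

lemma fderiv_profile_t_zero (N t : ℝ) :
    fderiv ℝ (profile δ τ η κ) (0, N, t, 0) (0, 0, 1, 0) = 0 := by
  have hl : HasDerivAt (fun s : ℝ => ((0 : ℝ), N, s, (0 : ℝ))) (0, 0, 1, 0) t :=
    (hasDerivAt_const _ _).prodMk ((hasDerivAt_const _ _).prodMk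
      ((hasDerivAt_id _).prodMk (hasDerivAt_const _ _)))
  have h := (differentiable_profile (δ := δ) (τ := τ) (η := η) (κ := κ)
    (0, N, t, 0)).hasFDerivAt.comp_hasDerivAt t hl
  refine h.unique ?_
  convert hasDerivAt_const t (0 : ℝ) using 1
  funext s
  simp [profile]

theorem exists_isPlugProfile {δ τ η M : ℝ} (hδ : 0 < δ) (hτ : 0 < τ) (hη : 0 < η) (hM : 0 ≤ M) :
    ∃ F, IsPlugProfile δ τ η M F := by
  obtain ⟨D, hD0, hD⟩ := exists_bound_deriv_plateau
  set q := smoothTransition (3 / 4) with hq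
  have hq1 : q < 1 := smoothTransition.lt_one_of_lt_one (by norm_num)
  have hq0 : 0 ≤ q := smoothTransition.nonneg _
  set κ := δ * (1 - q) / (2 * (M + 1) * (D + 1)) with hκ
  have hκ0 : 0 < κ := by have : 0 < 1 - q := by linarith
                         positivity
  have hκ1 : κ * M * (D + 1) ≤ δ * ((1 - q) / 2) := by
    rw [hκ, div_mul_eq_mul_div, div_mul_eq_mul_div, div_le_iff₀ (by positivity)]
    have : 0 ≤ δ * (1 - q) * (D + 1) := by have : 0 ≤ 1 - q := by linarith
                                           positivity
    nlinarith
  have hκ2 : κ * M ≤ δ / 2 := by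
    have : κ * M ≤ κ * M * (D + 1) := le_mul_of_one_le_right (by positivity) (by linarith)
    nlinarith
  clear_value κ q
  have hE : ∀ t : ℝ, |t / τ * twinPeaks (t / τ)| ≤ 1 := by
    intro t
    by_cases h : twinPeaks (t / τ) = 0
    · simp [h]
    · rw [abs_mul, abs_of_nonneg (twinPeaks_nonneg _)]
      have h1 := abs_le_of_twinPeaks_ne_zero h
      have h2 := twinPeaks_le_one (t / τ)
      have h3 := twinPeaks_nonneg (t / τ)
      have h4 := abs_nonneg (t / τ)
      nlinarith
  have speed : ∀ A N t r : ℝ, |A| ≤ M →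
      0 ≤ 1 + fderiv ℝ (profile δ τ η κ) (A, N, t, r) (0, 0, 0, 1) ∧
      (1 + fderiv ℝ (profile δ τ η κ) (A, N, t, r) (0, 0, 0, 1) = 0 →
        N = 0 ∧ (t = τ / 2 ∨ t = -(τ / 2)) ∧ r = 0) := by
    intro A N t r hA
    rw [fderiv_profile_r]
    have hb0 := peak_nonneg (N / η)
    have hb1 := peak_le_one (N / η)
    have ha0 := twinPeaks_nonneg (t / τ)
    have ha1 := twinPeaks_le_one (t / τ)
    have hB0 := peak_nonneg (r / δ)
    have hB1 := peak_le_one (r / δ)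
    have hdB := mul_deriv_peak_nonpos (r / δ)
    have hab0 : 0 ≤ twinPeaks (t / τ) * peak (N / η) := mul_nonneg ha0 hb0
    have hab1 : twinPeaks (t / τ) * peak (N / η) ≤ 1 := mul_le_one₀ ha1 hb0 hb1
    have hg : (peak (r / δ) + r / δ * deriv peak (r / δ)) * twinPeaks (t / τ) * peak (N / η) ≤
        peak (r / δ) * (twinPeaks (t / τ) * peak (N / η)) := by
      rw [mul_assoc]
      exact mul_le_mul_of_nonneg_right (by linarith) hab0
    by_cases hr : (r / δ) ^ 2 < 1 / 16
    · rw [deriv_plateau_eq_zero hr]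
      have hle : peak (r / δ) * (twinPeaks (t / τ) * peak (N / η)) ≤ 1 := mul_le_one₀ hB1 hab0 hab1
      refine ⟨by simp only [zero_div, mul_zero]; linarith, fun h0 => ?_⟩
      simp only [zero_div, mul_zero] at h0
      have h1 : peak (r / δ) * (twinPeaks (t / τ) * peak (N / η)) = 1 := by linarith
      have h2 : peak (r / δ) = 1 := le_antisymm hB1 (by nlinarith)
      rw [h2, one_mul] at h1
      have h3 : twinPeaks (t / τ) = 1 := le_antisymm ha1 (by nlinarith)
      rw [h3, one_mul] at h1
      refine ⟨?_, ?_, ?_⟩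
      · simpa [hη.ne'] using eq_zero_of_peak_eq_one h1
      · rcases eq_of_twinPeaks_eq_one h3 with h | h
        · left; field_simp at h; linarith
        · right; field_simp at h; linarith
      · simpa [hδ.ne'] using eq_zero_of_peak_eq_one h2
    · rw [not_lt] at hr
      have hBq := peak_le_of_sq_ge hr
      have h1 : peak (r / δ) * (twinPeaks (t / τ) * peak (N / η)) ≤ q := by
        calc _ ≤ peak (r / δ) * 1 := mul_le_mul_of_nonneg_left hab1 hB0
          _ ≤ q := by rw [mul_one]; exact hq ▸ hBq
      have h2 : |κ * A * peak (N / η) * (t / τ * twinPeaks (t / τ)) *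
          (deriv plateau (r / δ) / δ)| ≤ (1 - q) / 2 := by
        rw [abs_mul, abs_mul, abs_mul, abs_mul, abs_div, abs_of_pos hκ0, abs_of_pos hδ,
          abs_of_nonneg hb0]
        calc κ * |A| * peak (N / η) * |t / τ * twinPeaks (t / τ)| * (|deriv plateau (r / δ)| / δ)
            ≤ κ * M * 1 * 1 * ((D + 1) / δ) := by
              have := hE t
              have := (hD (r / δ)).trans (by linarith : D ≤ D + 1)
              gcongr
          _ ≤ (1 - q) / 2 := by
              rw [mul_one, mul_one, ← mul_div_assoc, div_le_iff₀ hδ]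
              linarith
      have h3 := (abs_le.1 h2).1
      have h4 : 0 < 1 - q := by linarith
      exact ⟨by linarith, fun h0 => absurd h0 (by linarith)⟩
  refine ⟨profile δ τ η κ, contDiff_profile, ?_, ?_, ?_, fun A N t r hA => (speed A N t r hA).1,
    fun A N t r hA => (speed A N t r hA).2, ?_, fderiv_profile_t_zero _ _, ?_, ?_⟩
  · intro A N t r h
    refine ⟨?_, ?_, ?_⟩
    · have : peak (N / η) ≠ 0 := fun h0 => h (by simp [profile, h0])
      have := abs_le_of_peak_ne_zero this
      rw [abs_div, abs_of_pos hη, div_le_iff₀ hη] at this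
      linarith
    · have : twinPeaks (t / τ) ≠ 0 := fun h0 => h (by simp [profile, h0])
      have := abs_le_of_twinPeaks_ne_zero this
      rwa [abs_div, abs_of_pos hτ, div_le_iff₀ hτ] at this
    · have : |r / δ| ≤ 1 / 2 := by
        by_cases h0 : peak (r / δ) = 0
        · refine abs_le_of_plateau_ne_zero fun h1 => h (by simp [profile, h0, h1])
        · exact abs_le_of_peak_ne_zero h0
      rw [abs_div, abs_of_pos hδ, div_le_iff₀ hδ] at this
      linarith
  · intro A N t r hA
    have h1 : |κ * A * peak (N / η) * (t / τ * twinPeaks (t / τ)) * plateau (r / δ)| ≤ δ / 2 := by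
      rw [abs_mul, abs_mul, abs_mul, abs_mul, abs_of_pos hκ0,
        abs_of_nonneg (peak_nonneg _), abs_of_nonneg (plateau_nonneg _)]
      calc κ * |A| * peak (N / η) * |t / τ * twinPeaks (t / τ)| * plateau (r / δ)
          ≤ κ * M * 1 * 1 * 1 := by
            have := hE t
            have := peak_le_one (N / η)
            have := peak_nonneg (N / η)
            have := plateau_le_one (r / δ)
            have := plateau_nonneg (r / δ)
            gcongr
        _ ≤ δ / 2 := by linarith
    have h2 : |r * peak (r / δ) * twinPeaks (t / τ) * peak (N / η)| ≤ δ / 2 := by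
      by_cases h0 : peak (r / δ) = 0
      · simp [h0]; positivity
      have := abs_le_of_peak_ne_zero h0
      rw [abs_div, abs_of_pos hδ, div_le_iff₀ hδ] at this
      rw [abs_mul, abs_mul, abs_mul, abs_of_nonneg (peak_nonneg _),
        abs_of_nonneg (twinPeaks_nonneg _), abs_of_nonneg (peak_nonneg _)]
      calc |r| * peak (r / δ) * twinPeaks (t / τ) * peak (N / η) ≤ (1 / 2 * δ) * 1 * 1 * 1 := by
            have := peak_le_one (N / η)
            have := peak_nonneg (N / η)
            have := peak_le_one (r / δ)
            have := peak_nonneg (r / δ)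
            have := twinPeaks_le_one (t / τ)
            have := twinPeaks_nonneg (t / τ)
            gcongr
        _ = δ / 2 := by ring
    calc _ ≤ _ := abs_sub _ _
      _ ≤ δ := by linarith
  · intro A N t r
    simp only [profile, neg_div, peak_neg, plateau_neg, twinPeaks_neg]
    ring
  · have h : -(τ / 2) / τ = -(1 / 2) := by field_simp
    rw [fderiv_profile_r, h, twinPeaks_of_eq (Or.inr rfl)]
    simp [peak_zero]
  · intro t ht
    have h : t / τ = 1 / 2 ∨ t / τ = -(1 / 2) := by
      rcases ht with rfl | rfl
      · left; field_simp
      · right; field_simp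
    rw [fderiv_profile_A, twinPeaks_of_eq h]
    have : t / τ ≠ 0 := by rcases h with h | h <;> rw [h] <;> norm_num
    simp [peak_zero, plateau_zero, hκ0.ne']
    simpa using this
  · intro t r h
    have h1 : r * (1 - peak (r / δ) * twinPeaks (t / τ)) = 0 := by
      simp [profile, peak_zero] at h
      linarith
    rcases mul_eq_zero.1 h1 with h1 | h1
    · exact h1
    · have h2 := twinPeaks_le_one (t / τ)
      have h3 := peak_le_one (r / δ)
      have h4 := peak_nonneg (r / δ)
      have h5 : peak (r / δ) = 1 := le_antisymm h3 (by nlinarith [twinPeaks_nonneg (t / τ)])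
      simpa [hδ.ne'] using eq_zero_of_peak_eq_one h5

end PlugProfile

/-- Normal form of an injective skew-adjoint operator on an even-dimensional Euclidean space. -/
theorem exists_skew_normal_form (m : ℕ) : ∀ (V : Type) [NormedAddCommGroup V]
    [InnerProductSpace ℝ V] [FiniteDimensional ℝ V] (A : V →ₗ[ℝ] V),
    Module.finrank ℝ V = 2 * m → (∀ x y, ⟪A x, y⟫ = -⟪x, A y⟫) → Function.Injective A →
    ∃ (e f : Fin m → V) (c : Fin m → ℝ), (∀ k, 0 < c k) ∧ (∀ k, A (e k) = c k • f k) ∧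
      (∀ k, A (f k) = -(c k • e k)) ∧ (∀ i j, ⟪e i, e j⟫ = if i = j then 1 else 0) ∧
      (∀ i j, ⟪f i, f j⟫ = if i = j then 1 else 0) ∧ ∀ i j, ⟪e i, f j⟫ = 0 := by
  induction m with
  | zero =>
    intro V _ _ _ A _ _ _
    exact ⟨fun k => k.elim0, fun k => k.elim0, fun k => k.elim0, fun k => k.elim0,
      fun k => k.elim0, fun k => k.elim0, fun k => k.elim0, fun k => k.elim0, fun k => k.elim0⟩
  | succ m ih =>
    intro V _ _ _ A hdim hskew hinj
    have : Nontrivial V := Module.nontrivial_of_finrank_pos (R := ℝ) (by omega)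
    have hsymm : (A ∘ₗ A).IsSymmetric := fun x y => by
      simp only [LinearMap.comp_apply]
      rw [hskew, hskew, neg_neg]
    obtain ⟨v, hv⟩ := hsymm.hasEigenvalue_iSup_of_finiteDimensional.exists_hasEigenvector
    set μ : ℝ := ⨆ x : { x : V // x ≠ 0 }, RCLike.re (inner ℝ ((A ∘ₗ A) ↑x) ↑x) / ‖(x : V)‖ ^ 2
    have hv0 : v ≠ 0 := hv.2
    have hAA : A (A v) = μ • v := by simpa using hv.apply_eq_smul
    set e₀ : V := ‖v‖⁻¹ • v with he₀
    have hne : ‖e₀‖ = 1 := norm_smul_inv_norm hv0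
    have hAe : A (A e₀) = μ • e₀ := by
      rw [he₀, map_smul, map_smul, hAA, smul_comm]
    have he0 : e₀ ≠ 0 := fun h => by simp [h] at hne
    have hAe0 : A e₀ ≠ 0 := fun h => he0 (hinj (by rw [h, map_zero]))
    set c₀ : ℝ := ‖A e₀‖ with hc₀
    have hc0 : 0 < c₀ := norm_pos_iff.2 hAe0
    have hμ : μ = -c₀ ^ 2 := by
      have h1 : ⟪A (A e₀), e₀⟫ = μ := by
        rw [hAe, real_inner_smul_left, real_inner_self_eq_norm_sq, hne]; ring
      rw [← h1, hskew, real_inner_self_eq_norm_sq]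
    set f₀ : V := c₀⁻¹ • A e₀ with hf₀
    have hnf : ‖f₀‖ = 1 := norm_smul_inv_norm hAe0
    have hAe₀ : A e₀ = c₀ • f₀ := by rw [hf₀, smul_inv_smul₀ hc0.ne']
    have hAf₀ : A f₀ = -(c₀ • e₀) := by
      rw [hf₀, map_smul, hAe, hμ, smul_smul, ← neg_smul]
      congr 1
      field_simp
    have hef : ⟪e₀, f₀⟫ = 0 := by
      have h1 : ⟪A e₀, e₀⟫ = 0 := by
        have := hskew e₀ e₀
        rw [real_inner_comm e₀ (A e₀)] at this
        rw [real_inner_comm]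
        linarith
      rw [hf₀, real_inner_smul_right, real_inner_comm, h1, mul_zero]
    have hfe : ⟪f₀, e₀⟫ = 0 := by rw [real_inner_comm, hef]
    clear_value f₀ c₀ e₀
    set P : Submodule ℝ V := Submodule.span ℝ {e₀, f₀} with hP
    have hmem : ∀ x : V, x ∈ Pᗮ ↔ ⟪e₀, x⟫ = 0 ∧ ⟪f₀, x⟫ = 0 := by
      intro x
      rw [Submodule.mem_orthogonal]
      constructor
      · intro h
        exact ⟨h _ (Submodule.subset_span (by simp)), h _ (Submodule.subset_span (by simp))⟩
      · rintro ⟨h1, h2⟩ u hu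
        obtain ⟨a, b, rfl⟩ := Submodule.mem_span_pair.1 hu
        rw [inner_add_left, real_inner_smul_left, real_inner_smul_left, h1, h2]
        simp
    have hPdim : Module.finrank ℝ P = 2 := by
      have hli : LinearIndependent ℝ ![e₀, f₀] := by
        have ho : Orthonormal ℝ ![e₀, f₀] := by
          rw [orthonormal_iff_ite]
          intro i j
          fin_cases i <;> fin_cases j <;>
            simp [hne, hnf, hef, hfe]
        exact ho.linearIndependent
      have hr : Set.range ![e₀, f₀] = {e₀, f₀} := by simp [Matrix.range_cons, Set.pair_comm]
      have := finrank_span_eq_card hli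
      rwa [hr, Fintype.card_fin] at this
    have hWdim : Module.finrank ℝ Pᗮ = 2 * m := by
      have := P.finrank_add_finrank_orthogonal
      omega
    have hmaps : ∀ x ∈ Pᗮ, A x ∈ Pᗮ := by
      intro x hx
      obtain ⟨h1, h2⟩ := (hmem x).1 hx
      rw [hmem]
      have h3 := hskew e₀ x
      have h4 := hskew f₀ x
      rw [hAe₀, real_inner_smul_left, h2] at h3
      rw [hAf₀, inner_neg_left, real_inner_smul_left, h1] at h4
      constructor <;> linarith
    obtain ⟨e, f, c, hc, hAe', hAf', hee, hff, hef'⟩ := ih Pᗮ (A.restrict hmaps) hWdim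
      (fun x y => hskew x y) (fun x y hxy => Subtype.ext (hinj (congrArg Subtype.val hxy)))
    have pe : ∀ k, ⟪e₀, (e k : V)⟫ = 0 ∧ ⟪f₀, (e k : V)⟫ = 0 := fun k => (hmem _).1 (e k).2
    have pf : ∀ k, ⟪e₀, (f k : V)⟫ = 0 ∧ ⟪f₀, (f k : V)⟫ = 0 := fun k => (hmem _).1 (f k).2
    refine ⟨Fin.cons e₀ fun k => (e k : V), Fin.cons f₀ fun k => (f k : V), Fin.cons c₀ c,
      Fin.cases hc0 hc, ?_, ?_, ?_, ?_, ?_⟩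
    · refine Fin.cases (by simpa using hAe₀) fun k => ?_
      simpa using congrArg Subtype.val (hAe' k)
    · refine Fin.cases (by simpa using hAf₀) fun k => ?_
      simpa using congrArg Subtype.val (hAf' k)
    · refine Fin.cases (Fin.cases ?_ fun j => ?_) fun i => Fin.cases ?_ fun j => ?_
      · simp [hne]
      · simp [(pe j).1, (Fin.succ_ne_zero j).symm]
      · simp [real_inner_comm e₀ (e i : V), (pe i).1, Fin.succ_ne_zero i]
      · simpa using hee i j
    · refine Fin.cases (Fin.cases ?_ fun j => ?_) fun i => Fin.cases ?_ fun j => ?_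
      · simp [hnf]
      · simp [(pf j).2, (Fin.succ_ne_zero j).symm]
      · simp [real_inner_comm f₀ (f i : V), (pf i).2, Fin.succ_ne_zero i]
      · simpa using hff i j
    · refine Fin.cases (Fin.cases ?_ fun j => ?_) fun i => Fin.cases ?_ fun j => ?_
      · simpa using hef
      · simp [(pf j).1]
      · simp [real_inner_comm f₀ (e i : V), (pe i).2]
      · simpa using hef' i j

/-- Orthonormal coordinates for a positive definite real quadratic form. -/
theorem exists_linearEquiv_norm_sq {E : Type} [AddCommGroup E] [Module ℝ E]
    [FiniteDimensional ℝ E] {Q : QuadraticForm ℝ E} (hQ : Q.PosDef) :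
    ∃ M : EuclideanSpace ℝ (Fin (Module.finrank ℝ E)) ≃ₗ[ℝ] E, ∀ x, Q (M x) = ‖x‖ ^ 2 := by
  obtain ⟨w, ⟨φ⟩⟩ := QuadraticForm.equivalent_signType_weighted_sum_squared Q
  have hφ : ∀ x, Q (φ.symm x) = ∑ i, ((w i : SignType) : ℝ) * (x i * x i) := by
    intro x
    rw [φ.symm.map_app]
    simp [QuadraticMap.weightedSumSquares_apply]
  have hw : ∀ i, w i = 1 := by
    intro i
    have h1 : (Pi.single i 1 : Fin (Module.finrank ℝ E) → ℝ) ≠ 0 := by simp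
    have h2 : φ.symm (Pi.single i 1) ≠ 0 := fun h => h1 (by
      have := congrArg φ.toLinearEquiv h
      simp at this)
    have h3 := hQ _ h2
    rw [hφ] at h3
    rw [Finset.sum_eq_single i (by intro j _ hj; simp [hj]) (by simp)] at h3
    cases h : w i
    · simp [h] at h3
    · simp [h] at h3; linarith
    · rfl
  refine ⟨(WithLp.linearEquiv 2 ℝ _).trans φ.symm.toLinearEquiv, fun x => ?_⟩
  have := hφ (WithLp.linearEquiv 2 ℝ _ x)
  rw [EuclideanSpace.norm_sq_eq]
  refine this.trans (Finset.sum_congr rfl fun i _ => ?_)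
  rw [hw]
  simp [sq]

lemma inner_eq_sum_re_im {n : ℕ} (x y : EuclideanSpace ℂ (Fin n)) :
    ⟪x, y⟫ = ∑ k, ((x k).re * (y k).re + (x k).im * (y k).im) := by
  rw [PiLp.inner_apply]
  refine Finset.sum_congr rfl fun k _ => ?_
  rw [Complex.inner]
  simp [Complex.mul_re]
  ring

lemma inner_I_smul_eq_sum {n : ℕ} (x y : EuclideanSpace ℂ (Fin n)) :
    ⟪Complex.I • x, y⟫ = ∑ k, ((x k).re * (y k).im - (x k).im * (y k).re) := by
  rw [inner_eq_sum_re_im]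
  refine Finset.sum_congr rfl fun k _ => ?_
  simp
  ring

/-- Williamson's theorem for positive definite quadratic forms. -/
theorem exists_symplectic_diagonalization {n : ℕ}
    {Q : QuadraticForm ℝ (EuclideanSpace ℂ (Fin n))} (hQ : Q.PosDef) :
    ∃ (L : EuclideanSpace ℂ (Fin n) ≃L[ℝ] EuclideanSpace ℂ (Fin n)) (a : Fin n → ℝ),
      (∀ k, 0 < a k) ∧ (∀ u v, ⟪Complex.I • L u, L v⟫ = ⟪Complex.I • u, v⟫) ∧
      ∀ z, Q (L z) = ∑ k, a k * ‖z k‖ ^ 2 := by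
  have hdim : Module.finrank ℝ (EuclideanSpace ℂ (Fin n)) = 2 * n := by
    rw [finrank_real_of_complex, finrank_euclideanSpace_fin]
  obtain ⟨M, hM⟩ := exists_linearEquiv_norm_sq hQ
  let J : EuclideanSpace ℂ (Fin n) →ₗ[ℝ] EuclideanSpace ℂ (Fin n) :=
    Complex.I • LinearMap.id
  have hJ : ∀ x, J x = Complex.I • x := fun x => rfl
  let A := (LinearMap.adjoint M.toLinearMap) ∘ₗ J ∘ₗ M.toLinearMap
  have hA : ∀ x y, ⟪A x, y⟫ = ⟪Complex.I • M x, M y⟫ := fun x y => by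
    simp [A, LinearMap.adjoint_inner_left, hJ]
  obtain ⟨e, f, c, hc, hAe, hAf, hee, hff, hef⟩ := exists_skew_normal_form n _ A
    (by rw [finrank_euclideanSpace_fin, hdim])
    (fun x y => by
      rw [← real_inner_comm x (A y), hA, hA, inner_I_smul_eq_sum,
        inner_I_smul_eq_sum, ← Finset.sum_neg_distrib]
      exact Finset.sum_congr rfl fun k _ => by ring)
    (by
      rw [injective_iff_map_eq_zero]
      intro x hx
      have h1 := hA x (M.symm (Complex.I • M x))
      rw [hx, inner_zero_left, M.apply_symm_apply, eq_comm, inner_self_eq_zero] at h1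
      simpa [Complex.I_ne_zero] using h1)
  let comb : (Fin n → ℝ) → (Fin n → ℝ) → EuclideanSpace ℝ _ := fun α β =>
    ∑ k, (α k • e k + β k • f k)
  have hinner : ∀ α β α' β' : Fin n → ℝ,
      ⟪comb α β, comb α' β'⟫ = ∑ k, (α k * α' k + β k * β' k) := by
    intro α β α' β'
    have hfe : ∀ i j, ⟪f i, e j⟫ = 0 := fun i j => by rw [real_inner_comm, hef]
    simp only [comb, sum_inner, inner_sum, inner_add_left, inner_add_right, real_inner_smul_left,
      real_inner_smul_right, hee, hff, hef, hfe]
    refine Finset.sum_congr rfl fun k _ => ?_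
    simp [mul_comm]
  have hAcomb : ∀ α β, A (comb α β) = comb (fun k => -(c k * β k)) fun k => c k * α k := by
    intro α β
    simp only [comb, map_sum, map_add, map_smul, hAe, hAf]
    refine Finset.sum_congr rfl fun k _ => ?_
    rw [smul_smul, smul_neg, smul_smul, neg_smul, add_comm, mul_comm (β k), mul_comm (α k)]
  let L₀ : EuclideanSpace ℂ (Fin n) →ₗ[ℝ] EuclideanSpace ℂ (Fin n) :=
    { toFun := fun z => M (comb (fun k => (z k).re / √(c k)) fun k => (z k).im / √(c k))
      map_add' := fun x y => by
        rw [← map_add]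
        congr 1
        simp only [comb, ← Finset.sum_add_distrib]
        refine Finset.sum_congr rfl fun k _ => ?_
        simp only [PiLp.add_apply, Complex.add_re, Complex.add_im, add_div]
        module
      map_smul' := fun s x => by
        rw [RingHom.id_apply, ← map_smul]
        congr 1
        simp only [comb, Finset.smul_sum]
        refine Finset.sum_congr rfl fun k _ => ?_
        simp only [PiLp.smul_apply, Complex.real_smul, Complex.re_ofReal_mul,
          Complex.im_ofReal_mul, mul_div_assoc]
        module }
  have hL₀ : ∀ z, L₀ z = M (comb (fun k => (z k).re / √(c k)) fun k => (z k).im / √(c k)) :=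
    fun z => rfl
  have hsq : ∀ k, √(c k) * √(c k) = c k := fun k => Real.mul_self_sqrt (hc k).le
  have hs0 : ∀ k, √(c k) ≠ 0 := fun k => (Real.sqrt_pos.2 (hc k)).ne'
  have hω : ∀ u v, ⟪Complex.I • L₀ u, L₀ v⟫ = ⟪Complex.I • u, v⟫ := by
    intro u v
    rw [hL₀, hL₀, ← hA, hAcomb, hinner, inner_I_smul_eq_sum]
    refine Finset.sum_congr rfl fun k _ => ?_
    have := hs0 k
    have h := hsq k
    generalize √(c k) = s at *
    rw [← h]
    field_simp
    ring
  have hinj : Function.Injective L₀ := by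
    rw [injective_iff_map_eq_zero]
    intro z hz
    have := hω z (Complex.I • z)
    rw [hz, smul_zero, inner_zero_left, eq_comm, inner_self_eq_zero] at this
    simpa [Complex.I_ne_zero] using this
  refine ⟨(LinearEquiv.ofInjectiveEndo L₀ hinj).toContinuousLinearEquiv, fun k => 1 / c k,
    fun k => one_div_pos.2 (hc k), fun u v => hω u v, fun z => ?_⟩
  change Q (L₀ z) = _
  rw [hL₀, hM, ← real_inner_self_eq_norm_sq, hinner]
  refine Finset.sum_congr rfl fun k _ => ?_
  have := hs0 k
  have h := hsq k
  rw [← Complex.normSq_eq_norm_sq, Complex.normSq_apply]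
  generalize √(c k) = s at *
  beta_reduce
  rw [← h]
  field_simp

/-- The components of `a` are pairwise rationally independent. -/
def PairwiseIncommensurable {n : ℕ} (a : Fin n → ℝ) : Prop :=
  ∀ j l, j ≠ l → ∀ m p : ℤ, (m : ℝ) * a j = p * a l → m = 0

lemma exists_pairwiseIncommensurable {n : ℕ} (a : Fin n → ℝ) (ha : ∀ k, 0 < a k) {η : ℝ}
    (hη : 0 < η) : ∃ b : Fin n → ℝ, (∀ k, a k ≤ b k) ∧ (∀ k, b k ≤ (1 + η) * a k) ∧
      PairwiseIncommensurable b := by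
  obtain ⟨x, hx, hx0⟩ : ∃ x : ℝ, Transcendental ℚ x ∧ x ≠ 0 := by
    have h := transcendental_liouvilleNumber (m := 2) le_rfl
    exact ⟨_, mt (IsFractionRing.isAlgebraic_iff ℤ ℚ ℝ).2 h,
      fun h0 => h (by rw [h0]; exact isAlgebraic_zero)⟩
  have hpow : ∀ k : Fin n, 0 < x ^ (2 * (k : ℕ)) := fun k => by rw [pow_mul]; positivity
  have hq : ∀ k, ∃ q : ℚ, a k / x ^ (2 * (k : ℕ)) < q ∧
      q < (1 + η) * a k / x ^ (2 * (k : ℕ)) := fun k =>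
    exists_rat_btwn (div_lt_div_of_pos_right (by nlinarith [ha k]) (hpow k))
  choose q hq1 hq2 using hq
  have hq0 : ∀ k, (q k : ℝ) ≠ 0 := fun k => ((div_pos (ha k) (hpow k)).trans (hq1 k)).ne'
  refine ⟨fun k => q k * x ^ (2 * (k : ℕ)), fun k => ((div_lt_iff₀ (hpow k)).1 (hq1 k)).le,
    fun k => ((lt_div_iff₀ (hpow k)).1 (hq2 k)).le, fun j l hjl m p h => ?_⟩
  by_contra hm
  refine hx ⟨Polynomial.C (m * q j) * Polynomial.X ^ (2 * (j : ℕ)) -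
    Polynomial.C (p * q l) * Polynomial.X ^ (2 * (l : ℕ)), fun h0 => ?_, ?_⟩
  · have hne : (2 * (j : ℕ)) ≠ 2 * (l : ℕ) := fun h => hjl (Fin.ext (by omega))
    have := congrArg (fun P => Polynomial.coeff P (2 * (j : ℕ))) h0
    simp only [Polynomial.coeff_sub, Polynomial.coeff_C_mul, Polynomial.coeff_X_pow, if_neg hne,
      if_true, Polynomial.coeff_zero, mul_one, mul_zero, sub_zero, mul_eq_zero] at this
    rcases this with h1 | h1
    · exact hm (by exact_mod_cast h1)
    · exact hq0 j (by exact_mod_cast h1)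
  · simp only [map_sub, map_mul, Polynomial.aeval_C, map_pow, Polynomial.aeval_X]
    simp only [eq_ratCast, Rat.cast_intCast]
    linarith

lemma eq_zero_of_exp_eq_one {n : ℕ} {a : Fin n → ℝ} (ha : ∀ k, 0 < a k)
    (hirr : PairwiseIncommensurable a) {j l : Fin n} (hjl : j ≠ l) {θ : ℝ}
    (hj : Complex.exp (2 * a j * θ * Complex.I) = 1)
    (hl : Complex.exp (2 * a l * θ * Complex.I) = 1) : θ = 0 := by
  obtain ⟨m, hm⟩ := Complex.exp_eq_one_iff.1 hj
  obtain ⟨p, hp⟩ := Complex.exp_eq_one_iff.1 hl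
  have hm' : a j * θ = m * Real.pi := by
    have := congrArg Complex.im hm
    simp at this
    linarith
  have hp' : a l * θ = p * Real.pi := by
    have := congrArg Complex.im hp
    simp at this
    linarith
  by_contra hθ
  have h0 : p = 0 := hirr j l hjl p m (mul_right_cancel₀ hθ (by
    rw [mul_assoc, mul_assoc, hm', hp']; ring))
  rw [h0] at hp'
  simp [hθ, (ha l).ne'] at hp'

/-- Parameters of a Hamiltonian obtained from the ellipsoid `∑ a k ‖z k‖ ^ 2 = 1` by inserting a
plug across each of the closed orbits in the coordinate axes. -/
structure PlugSystem (n : ℕ) where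
  a : Fin n → ℝ
  c : ℝ
  τ : ℝ
  δ : ℝ
  M : ℝ
  F : ℝ × ℝ × ℝ × ℝ → ℝ
  a_pos : ∀ k, 0 < a k
  c_pos : 0 < c
  τ_pos : 0 < τ
  δ_pos : 0 < δ
  two_mul_a_mul_τ_le : ∀ k, 2 * a k * τ ≤ 1
  sum_a_mul_sq_le : ∑ k, a k * (3 * c) ^ 2 ≤ 1 / 4
  sum_a_mul_c_sq_le : ∑ k, a k * c ^ 2 ≤ M
  mul_δ_le : n * δ ≤ 1 / 4
  profile : IsPlugProfile δ τ (c ^ 4) M F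

lemma inner_single_left_real {n : ℕ} (k : Fin n) (w : ℂ) (u : EuclideanSpace ℂ (Fin n)) :
    ⟪EuclideanSpace.single k w, u⟫ = w.re * (u k).re + w.im * (u k).im := by
  rw [inner_eq_sum_re_im, Finset.sum_eq_single k]
  · simp
  · intro j _ hj
    simp [hj]
  · simp

namespace PlugSystem

variable {n : ℕ} (S : PlugSystem n)

/-- The time coordinate near the `k`-th axis. -/
noncomputable def time (k : Fin n) (z : EuclideanSpace ℂ (Fin n)) : ℝ :=
  (Complex.log (z k)).im / (2 * S.a k)

/-- The coordinate `z l` transported back to the section `time = 0`. -/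
noncomputable def rot (k l : Fin n) (z : EuclideanSpace ℂ (Fin n)) : ℂ :=
  Complex.exp (-(2 * S.a l * S.time k z : ℝ) * Complex.I) * z l

/-- The action of the rotation about the displaced centre `c` in the `l`-th factor. -/
noncomputable def action (k l : Fin n) (z : EuclideanSpace ℂ (Fin n)) : ℝ :=
  ‖z l‖ ^ 2 / 2 - S.c * (S.rot k l z).re

/-- The weighted sum of the actions. -/
noncomputable def weighted (k : Fin n) (z : EuclideanSpace ℂ (Fin n)) : ℝ :=
  ∑ l ∈ Finset.univ.erase k, S.a l * S.action k l z

/-- The sum of the squares of the actions. -/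
noncomputable def sqSum (k : Fin n) (z : EuclideanSpace ℂ (Fin n)) : ℝ :=
  ∑ l ∈ Finset.univ.erase k, S.action k l z ^ 2

/-- The unperturbed quadratic Hamiltonian. -/
noncomputable def quad (z : EuclideanSpace ℂ (Fin n)) : ℝ := ∑ k, S.a k * ‖z k‖ ^ 2

/-- The arguments at which the profile of the `k`-th plug is evaluated. -/
noncomputable def coord (k : Fin n) (z : EuclideanSpace ℂ (Fin n)) : ℝ × ℝ × ℝ × ℝ :=
  (S.weighted k z, S.sqSum k z, S.time k z, S.quad z - 1)

/-- The perturbation across the `k`-th axis. -/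
noncomputable def plug (k : Fin n) (z : EuclideanSpace ℂ (Fin n)) : ℝ :=
  if 0 < (z k).re then S.F (S.coord k z) else 0

/-- The open region of the `k`-th plug. -/
def region (k : Fin n) : Set (EuclideanSpace ℂ (Fin n)) :=
  {z | 0 < (z k).re ∧ |S.time k z| < S.τ ∧ S.sqSum k z < S.c ^ 4}

/-- The perturbed Hamiltonian. -/
noncomputable def ham (z : EuclideanSpace ℂ (Fin n)) : ℝ := S.quad z + ∑ k, S.plug k z

lemma rot_re (k l : Fin n) (z : EuclideanSpace ℂ (Fin n)) :
    (S.rot k l z).re = Real.cos (2 * S.a l * S.time k z) * (z l).re +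
      Real.sin (2 * S.a l * S.time k z) * (z l).im := by
  rw [rot]
  generalize 2 * S.a l * S.time k z = θ
  rw [← Complex.ofReal_neg, Complex.exp_mul_I, ← Complex.ofReal_cos, ← Complex.ofReal_sin]
  simp [Complex.cos_ofReal_re, Complex.sin_ofReal_re]

lemma rot_im (k l : Fin n) (z : EuclideanSpace ℂ (Fin n)) :
    (S.rot k l z).im = Real.cos (2 * S.a l * S.time k z) * (z l).im -
      Real.sin (2 * S.a l * S.time k z) * (z l).re := by
  rw [rot]
  generalize 2 * S.a l * S.time k z = θ
  rw [← Complex.ofReal_neg, Complex.exp_mul_I, ← Complex.ofReal_cos, ← Complex.ofReal_sin]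
  simp [Complex.cos_ofReal_re, Complex.sin_ofReal_re]
  ring

lemma hasFDerivAt_coord (l : Fin n) (z : EuclideanSpace ℂ (Fin n)) :
    HasFDerivAt (fun z : EuclideanSpace ℂ (Fin n) => z l)
      (PiLp.proj (𝕜 := ℝ) 2 (fun _ : Fin n => ℂ) l) z :=
  (PiLp.proj (𝕜 := ℝ) 2 (fun _ : Fin n => ℂ) l).hasFDerivAt

lemma hasFDerivAt_re (l : Fin n) (z : EuclideanSpace ℂ (Fin n)) :
    HasFDerivAt (fun z : EuclideanSpace ℂ (Fin n) => (z l).re)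
      (innerSL ℝ (EuclideanSpace.single l (1 : ℂ))) z := by
  refine (Complex.reCLM.hasFDerivAt.comp z (hasFDerivAt_coord l z)).congr_fderiv ?_
  refine ContinuousLinearMap.ext fun u => ?_
  rw [innerSL_apply_apply, inner_single_left_real]
  simp

lemma hasFDerivAt_im (l : Fin n) (z : EuclideanSpace ℂ (Fin n)) :
    HasFDerivAt (fun z : EuclideanSpace ℂ (Fin n) => (z l).im)
      (innerSL ℝ (EuclideanSpace.single l Complex.I)) z := by
  refine (Complex.imCLM.hasFDerivAt.comp z (hasFDerivAt_coord l z)).congr_fderiv ?_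
  refine ContinuousLinearMap.ext fun u => ?_
  rw [innerSL_apply_apply, inner_single_left_real]
  simp

lemma hasFDerivAt_norm_sq (l : Fin n) (z : EuclideanSpace ℂ (Fin n)) :
    HasFDerivAt (fun z : EuclideanSpace ℂ (Fin n) => ‖z l‖ ^ 2)
      (innerSL ℝ (EuclideanSpace.single l (2 * z l))) z := by
  have h0 : (fun z : EuclideanSpace ℂ (Fin n) => ‖z l‖ ^ 2) =
      fun z => (z l).re * (z l).re + (z l).im * (z l).im := by
    funext z
    rw [← Complex.normSq_eq_norm_sq, Complex.normSq_apply]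
  rw [h0]
  refine (((hasFDerivAt_re l z).mul (hasFDerivAt_re l z)).add
    ((hasFDerivAt_im l z).mul (hasFDerivAt_im l z))).congr_fderiv ?_
  refine ContinuousLinearMap.ext fun u => ?_
  simp only [add_apply, smul_apply, innerSL_apply_apply,
    inner_single_left_real]
  simp
  ring

lemma hasFDerivAt_quad (z : EuclideanSpace ℂ (Fin n)) :
    HasFDerivAt S.quad
      (innerSL ℝ (∑ l, EuclideanSpace.single l (2 * S.a l * z l))) z := by
  refine (HasFDerivAt.fun_sum (u := Finset.univ)
    fun l _ => (hasFDerivAt_norm_sq l z).const_mul (S.a l)).congr_fderiv ?_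
  refine ContinuousLinearMap.ext fun u => ?_
  simp only [sum_apply, smul_apply, innerSL_apply_apply,
    sum_inner, inner_single_left_real]
  refine Finset.sum_congr rfl fun k _ => ?_
  simp
  ring

/-- The gradient of the time coordinate. -/
noncomputable def gradTime (k : Fin n) (z : EuclideanSpace ℂ (Fin n)) :
    EuclideanSpace ℂ (Fin n) :=
  EuclideanSpace.single k (Complex.I * z k / (2 * S.a k * ‖z k‖ ^ 2 : ℝ))

lemma hasFDerivAt_time {k : Fin n} {z : EuclideanSpace ℂ (Fin n)} (hz : 0 < (z k).re) :
    HasFDerivAt (S.time k) (innerSL ℝ (S.gradTime k z)) z := by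
  have hs : z k ∈ Complex.slitPlane := Or.inl hz
  have h2 := (Complex.hasDerivAt_log hs).complexToReal_fderiv.comp z (hasFDerivAt_coord k z)
  refine (((Complex.imCLM.hasFDerivAt).comp z h2).mul_const (2 * S.a k)⁻¹).congr_fderiv ?_
  have hn : (0 : ℝ) < ‖z k‖ ^ 2 := by
    have : z k ≠ 0 := fun h => by simp [h] at hz
    positivity
  have ha := S.a_pos k
  rw [← Complex.normSq_eq_norm_sq] at hn
  refine ContinuousLinearMap.ext fun u => ?_
  rw [innerSL_apply_apply, gradTime, inner_single_left_real, Complex.div_ofReal_re,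
    Complex.div_ofReal_im, ← Complex.normSq_eq_norm_sq]
  simp
  field_simp
  ring

/-- The gradient of the action. -/
noncomputable def gradAction (k l : Fin n) (z : EuclideanSpace ℂ (Fin n)) :
    EuclideanSpace ℂ (Fin n) :=
  EuclideanSpace.single l (z l - S.c * Complex.exp ((2 * S.a l * S.time k z : ℝ) * Complex.I)) -
    (2 * S.a l * S.c * (S.rot k l z).im) • S.gradTime k z

lemma hasFDerivAt_action {k : Fin n} (l : Fin n) {z : EuclideanSpace ℂ (Fin n)}
    (hz : 0 < (z k).re) :
    HasFDerivAt (S.action k l) (innerSL ℝ (S.gradAction k l z)) z := by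
  have ht := (S.hasFDerivAt_time hz).const_mul (2 * S.a l)
  have h0 : S.action k l = fun z => ‖z l‖ ^ 2 * (1 / 2) -
      S.c * (Real.cos (2 * S.a l * S.time k z) * (z l).re +
        Real.sin (2 * S.a l * S.time k z) * (z l).im) := by
    funext z
    rw [action, rot_re]
    ring
  rw [h0]
  refine (((hasFDerivAt_norm_sq l z).mul_const (1 / 2)).sub
    (((ht.cos.mul (hasFDerivAt_re l z)).add
      (ht.sin.mul (hasFDerivAt_im l z))).const_mul S.c)).congr_fderiv ?_
  refine ContinuousLinearMap.ext fun u => ?_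
  rw [gradAction, rot_im]
  simp only [add_apply, sub_apply,
    smul_apply, innerSL_apply_apply, inner_sub_left, real_inner_smul_left,
    inner_single_left_real]
  generalize ⟪S.gradTime k z, u⟫ = v
  generalize 2 * S.a l * S.time k z = θ
  rw [Complex.exp_mul_I, ← Complex.ofReal_cos, ← Complex.ofReal_sin]
  simp [Complex.cos_ofReal_re, Complex.sin_ofReal_re]
  ring

/-- The derivative of the profile of the `k`-th plug in the direction `v`. -/
noncomputable def dF (k : Fin n) (z : EuclideanSpace ℂ (Fin n)) (v : ℝ × ℝ × ℝ × ℝ) : ℝ :=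
  fderiv ℝ S.F (S.coord k z) v

/-- The angular speed of the `l`-th factor inside the `k`-th plug. -/
noncomputable def speed (k l : Fin n) (z : EuclideanSpace ℂ (Fin n)) : ℝ :=
  S.dF k z (1, 0, 0, 0) * S.a l + 2 * S.action k l z * S.dF k z (0, 1, 0, 0)

lemma hasFDerivAt_F_comp_coord {k : Fin n} {z : EuclideanSpace ℂ (Fin n)}
    (hz : 0 < (z k).re) :
    HasFDerivAt (fun z => S.F (S.coord k z)) (innerSL ℝ
      (∑ l ∈ Finset.univ.erase k, S.speed k l z • S.gradAction k l z +
        S.dF k z (0, 0, 1, 0) • S.gradTime k z + S.dF k z (0, 0, 0, 1) •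
          ∑ l, EuclideanSpace.single l (2 * S.a l * z l))) z := by
  have hF : HasFDerivAt S.F (fderiv ℝ S.F (S.coord k z)) (S.coord k z) :=
    (S.profile.contDiff.differentiable (by simp) _).hasFDerivAt
  have hA : HasFDerivAt (S.weighted k)
      (∑ l ∈ Finset.univ.erase k, S.a l • innerSL ℝ (S.gradAction k l z)) z :=
    HasFDerivAt.fun_sum fun l _ => (S.hasFDerivAt_action l hz).const_mul (S.a l)
  have hN : HasFDerivAt (S.sqSum k)
      (∑ l ∈ Finset.univ.erase k, (2 • S.action k l z ^ (2 - 1)) •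
        innerSL ℝ (S.gradAction k l z)) z :=
    HasFDerivAt.fun_sum fun l _ => (S.hasFDerivAt_action l hz).pow 2
  have hc := hA.prodMk (hN.prodMk ((S.hasFDerivAt_time hz).prodMk
    ((S.hasFDerivAt_quad z).sub_const 1)))
  refine (hF.comp z hc).congr_fderiv (ContinuousLinearMap.ext fun u => ?_)
  have hlin : ∀ (D : ℝ × ℝ × ℝ × ℝ →L[ℝ] ℝ) (p q r s : ℝ), D (p, q, r, s) =
      p * D (1, 0, 0, 0) + q * D (0, 1, 0, 0) + r * D (0, 0, 1, 0) + s * D (0, 0, 0, 1) := by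
    intro D p q r s
    simp only [← smul_eq_mul, ← map_smul, ← map_add]
    simp
  simp only [speed, dF]
  generalize fderiv ℝ S.F (S.coord k z) = D
  refine (hlin D _ _ _ _).trans ?_
  simp only [ContinuousLinearMap.coe_coe, sum_apply, smul_apply, innerSL_apply_apply,
    inner_add_left, real_inner_smul_left,
    sum_inner, smul_eq_mul, Finset.sum_mul]
  rw [← Finset.sum_add_distrib]
  congr 2
  · refine Finset.sum_congr rfl fun l _ => ?_
    simp
    ring
  · ring
  · rw [Finset.mul_sum]
    exact Finset.sum_congr rfl fun l _ => by ring

open Filter Topology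

lemma norm_rot (k l : Fin n) (z : EuclideanSpace ℂ (Fin n)) : ‖S.rot k l z‖ = ‖z l‖ := by
  rw [rot, norm_mul, ← Complex.ofReal_neg, Complex.norm_exp_ofReal_mul_I, one_mul]

lemma two_mul_action (k l : Fin n) (z : EuclideanSpace ℂ (Fin n)) :
    2 * S.action k l z = ‖S.rot k l z - S.c‖ ^ 2 - S.c ^ 2 := by
  rw [action, ← S.norm_rot k l, ← Complex.normSq_eq_norm_sq, ← Complex.normSq_eq_norm_sq,
    Complex.normSq_apply, Complex.normSq_apply]
  simp
  ring

lemma action_sq_le_sqSum {k l : Fin n} (hl : l ≠ k) (z : EuclideanSpace ℂ (Fin n)) :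
    S.action k l z ^ 2 ≤ S.sqSum k z :=
  Finset.single_le_sum (f := fun l => S.action k l z ^ 2) (fun _ _ => sq_nonneg _)
    (Finset.mem_erase.2 ⟨hl, Finset.mem_univ l⟩)

lemma abs_action_le {k l : Fin n} (hl : l ≠ k) {z : EuclideanSpace ℂ (Fin n)}
    (h : S.sqSum k z ≤ S.c ^ 4) : |S.action k l z| ≤ S.c ^ 2 :=
  abs_le_of_sq_le_sq (((S.action_sq_le_sqSum hl z).trans h).trans_eq (by ring)) (sq_nonneg _)

lemma norm_le_of_sqSum_le {k l : Fin n} (hl : l ≠ k) {z : EuclideanSpace ℂ (Fin n)}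
    (h : S.sqSum k z ≤ S.c ^ 4) : ‖z l‖ ≤ 3 * S.c := by
  have h1 := (abs_le.1 (S.abs_action_le hl h)).2
  have h2 : (S.rot k l z).re ≤ ‖z l‖ := (Complex.re_le_norm _).trans_eq (S.norm_rot k l z)
  rw [action] at h1
  have := S.c_pos
  nlinarith [norm_nonneg (z l)]

lemma abs_weighted_le {k : Fin n} {z : EuclideanSpace ℂ (Fin n)}
    (h : S.sqSum k z ≤ S.c ^ 4) : |S.weighted k z| ≤ S.M := by
  calc |S.weighted k z| ≤ ∑ l ∈ Finset.univ.erase k, |S.a l * S.action k l z| :=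
        Finset.abs_sum_le_sum_abs _ _
    _ ≤ ∑ l ∈ Finset.univ.erase k, S.a l * S.c ^ 2 := Finset.sum_le_sum fun l hl => by
        rw [abs_mul, abs_of_pos (S.a_pos l)]
        exact mul_le_mul_of_nonneg_left (S.abs_action_le (Finset.ne_of_mem_erase hl) h)
          (S.a_pos l).le
    _ ≤ ∑ l, S.a l * S.c ^ 2 := Finset.sum_le_univ_sum_of_nonneg fun l =>
        mul_nonneg (S.a_pos l).le (sq_nonneg _)
    _ ≤ S.M := S.sum_a_mul_c_sq_le

lemma quad_le_of_sqSum_le {k : Fin n} {z : EuclideanSpace ℂ (Fin n)}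
    (h : S.sqSum k z ≤ S.c ^ 4) : S.quad z ≤ S.a k * ‖z k‖ ^ 2 + 1 / 4 := by
  rw [quad, ← Finset.add_sum_erase _ _ (Finset.mem_univ k)]
  gcongr
  calc ∑ l ∈ Finset.univ.erase k, S.a l * ‖z l‖ ^ 2
      ≤ ∑ l ∈ Finset.univ.erase k, S.a l * (3 * S.c) ^ 2 := Finset.sum_le_sum fun l hl => by
        have := S.norm_le_of_sqSum_le (Finset.ne_of_mem_erase hl) h
        have := (S.a_pos l).le
        gcongr
    _ ≤ ∑ l, S.a l * (3 * S.c) ^ 2 := Finset.sum_le_univ_sum_of_nonneg fun l =>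
        mul_nonneg (S.a_pos l).le (sq_nonneg _)
    _ ≤ 1 / 4 := S.sum_a_mul_sq_le

lemma a_mul_norm_sq_le {k l : Fin n} (hl : l ≠ k) {z : EuclideanSpace ℂ (Fin n)}
    (h : S.sqSum k z ≤ S.c ^ 4) : S.a l * ‖z l‖ ^ 2 ≤ 1 / 4 := by
  have := S.norm_le_of_sqSum_le hl h
  have := (S.a_pos l).le
  calc S.a l * ‖z l‖ ^ 2 ≤ S.a l * (3 * S.c) ^ 2 := by gcongr
    _ ≤ ∑ l, S.a l * (3 * S.c) ^ 2 := Finset.single_le_sum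
        (f := fun l => S.a l * (3 * S.c) ^ 2) (fun l _ => mul_nonneg (S.a_pos l).le (sq_nonneg _))
        (Finset.mem_univ l)
    _ ≤ 1 / 4 := S.sum_a_mul_sq_le

lemma quad_le_of_mem_inter {k l : Fin n} (hl : l ≠ k) {z : EuclideanSpace ℂ (Fin n)}
    (hk : z ∈ S.region k) (h : z ∈ S.region l) : S.quad z ≤ 1 / 2 := by
  have h1 := S.quad_le_of_sqSum_le hk.2.2.le
  have h2 := S.a_mul_norm_sq_le hl.symm h.2.2.le
  linarith

lemma δ_le (k : Fin n) : S.δ ≤ 1 / 4 := by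
  have h1 : (1 : ℝ) ≤ n := by
    exact_mod_cast Nat.one_le_iff_ne_zero.2 (fun h => by subst h; exact k.elim0)
  nlinarith [S.mul_δ_le, S.δ_pos]

lemma of_plug_ne_zero {k : Fin n} {z : EuclideanSpace ℂ (Fin n)} (h : S.plug k z ≠ 0) :
    0 < (z k).re ∧ S.sqSum k z ≤ S.c ^ 4 / 2 ∧ |S.time k z| ≤ 3 / 4 * S.τ ∧
      |S.quad z - 1| ≤ S.δ / 2 := by
  rw [plug] at h
  split_ifs at h with hz
  · obtain ⟨h1, h2, h3⟩ := S.profile.support _ _ _ _ h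
    exact ⟨hz, (le_abs_self _).trans h1, h2, h3⟩
  · exact absurd rfl h

lemma sqSum_le_of_plug_ne_zero {k : Fin n} {z : EuclideanSpace ℂ (Fin n)} (h : S.plug k z ≠ 0) :
    S.sqSum k z ≤ S.c ^ 4 :=
  (S.of_plug_ne_zero h).2.1.trans (half_le_self (pow_nonneg S.c_pos.le 4))

lemma abs_plug_le (k : Fin n) (z : EuclideanSpace ℂ (Fin n)) : |S.plug k z| ≤ S.δ := by
  by_cases h : S.plug k z = 0
  · rw [h, abs_zero]
    exact S.δ_pos.le
  · have h1 := S.abs_weighted_le (S.sqSum_le_of_plug_ne_zero h)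
    rw [plug, if_pos (S.of_plug_ne_zero h).1]
    exact S.profile.abs_le _ _ _ _ h1

lemma abs_ham_sub_quad_le (z : EuclideanSpace ℂ (Fin n)) : |S.ham z - S.quad z| ≤ n * S.δ := by
  rw [ham, add_sub_cancel_left]
  refine (Finset.abs_sum_le_sum_abs _ _).trans ?_
  refine (Finset.sum_le_sum fun k _ => S.abs_plug_le k z).trans ?_
  simp

lemma three_quarters_le_quad {z : EuclideanSpace ℂ (Fin n)} (h : S.ham z = 1) :
    3 / 4 ≤ S.quad z := by
  have h1 := (abs_le.1 (S.abs_ham_sub_quad_le z)).2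
  have := S.mul_δ_le
  linarith

lemma two_mul_a_mul_time (k : Fin n) (z : EuclideanSpace ℂ (Fin n)) :
    2 * S.a k * S.time k z = (z k).arg := by
  rw [time, Complex.log_im, mul_div_cancel₀]
  exact (mul_pos two_pos (S.a_pos k)).ne'

/-- Plugs stay away from the boundary of the half space in which they are defined. -/
lemma exists_le_re (k : Fin n) : ∃ m > 0, ∀ z : EuclideanSpace ℂ (Fin n), |S.time k z| ≤ S.τ →
    S.sqSum k z ≤ S.c ^ 4 → 3 / 4 ≤ S.quad z → m ≤ (z k).re := by
  have ha := S.a_pos k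
  have hc : 0 < Real.cos 1 := Real.cos_pos_of_mem_Ioo
    ⟨by linarith [Real.pi_gt_three], by linarith [Real.pi_gt_three]⟩
  refine ⟨√(1 / (2 * S.a k)) * Real.cos 1, by positivity, fun z ht hN hq => ?_⟩
  have h1 := S.quad_le_of_sqSum_le hN
  have h2 : √(1 / (2 * S.a k)) ≤ ‖z k‖ := by
    refine Real.sqrt_le_iff.2 ⟨norm_nonneg _, ?_⟩
    rw [div_le_iff₀ (by positivity)]
    linarith
  have h3 : |(z k).arg| ≤ 1 := by
    rw [← S.two_mul_a_mul_time, abs_mul, abs_of_pos (by positivity)]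
    exact (mul_le_mul_of_nonneg_left ht (by positivity)).trans (S.two_mul_a_mul_τ_le k)
  have h4 : Real.cos 1 ≤ Real.cos (z k).arg := by
    rw [← Real.cos_abs (z k).arg]
    exact Real.cos_le_cos_of_nonneg_of_le_pi (abs_nonneg _) (by linarith [Real.pi_gt_three]) h3
  rw [← Complex.norm_mul_cos_arg]
  gcongr

lemma contDiff_coord (l : Fin n) :
    ContDiff ℝ (⊤ : ℕ∞) fun z : EuclideanSpace ℂ (Fin n) => z l :=
  (PiLp.proj (𝕜 := ℝ) 2 (fun _ : Fin n => ℂ) l).contDiff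

lemma contDiffAt_time {k : Fin n} {z : EuclideanSpace ℂ (Fin n)} (hz : 0 < (z k).re) :
    ContDiffAt ℝ (⊤ : ℕ∞) (S.time k) z := by
  have h1 : ContDiffAt ℝ (⊤ : ℕ∞) Complex.log (z k) :=
    (Complex.contDiffAt_log (n := (⊤ : ℕ∞)) (Or.inl hz)).restrict_scalars ℝ
  exact (Complex.imCLM.contDiff.contDiffAt.comp z
    (h1.comp z (contDiff_coord k).contDiffAt)).div_const _

lemma contDiff_quad : ContDiff ℝ (⊤ : ℕ∞) S.quad :=
  ContDiff.sum fun l _ => contDiff_const.mul ((contDiff_coord l).norm_sq ℝ)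

lemma contDiffAt_rot {k : Fin n} (l : Fin n) {z : EuclideanSpace ℂ (Fin n)} (hz : 0 < (z k).re) :
    ContDiffAt ℝ (⊤ : ℕ∞) (S.rot k l) z := by
  have h1 := contDiffAt_const (c := 2 * S.a l) |>.mul (S.contDiffAt_time hz)
  have h2 : ContDiffAt ℝ (⊤ : ℕ∞) (fun z => ((2 * S.a l * S.time k z : ℝ) : ℂ)) z :=
    Complex.ofRealCLM.contDiff.contDiffAt.comp z h1
  exact (h2.neg.mul contDiffAt_const).cexp.mul (contDiff_coord l).contDiffAt

lemma contDiffAt_action {k : Fin n} (l : Fin n) {z : EuclideanSpace ℂ (Fin n)}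
    (hz : 0 < (z k).re) : ContDiffAt ℝ (⊤ : ℕ∞) (S.action k l) z :=
  (((contDiff_coord l).norm_sq ℝ).contDiffAt.div_const _).sub (contDiffAt_const.mul
    (Complex.reCLM.contDiff.contDiffAt.comp z (S.contDiffAt_rot l hz)))

lemma contDiffAt_sqSum {k : Fin n} {z : EuclideanSpace ℂ (Fin n)} (hz : 0 < (z k).re) :
    ContDiffAt ℝ (⊤ : ℕ∞) (S.sqSum k) z :=
  ContDiffAt.sum fun l _ => (S.contDiffAt_action l hz).pow 2

lemma contDiffAt_weighted {k : Fin n} {z : EuclideanSpace ℂ (Fin n)} (hz : 0 < (z k).re) :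
    ContDiffAt ℝ (⊤ : ℕ∞) (S.weighted k) z :=
  ContDiffAt.sum fun l _ => contDiffAt_const.mul (S.contDiffAt_action l hz)

lemma isOpen_half (k : Fin n) : IsOpen {z : EuclideanSpace ℂ (Fin n) | 0 < (z k).re} :=
  isOpen_lt continuous_const (Complex.continuous_re.comp (contDiff_coord k).continuous)

lemma plug_eventuallyEq {k : Fin n} {z : EuclideanSpace ℂ (Fin n)} (hz : 0 < (z k).re) :
    S.plug k =ᶠ[𝓝 z] fun z => S.F (S.coord k z) := by
  filter_upwards [(isOpen_half k).mem_nhds hz] with w hw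
  exact if_pos hw

lemma plug_eventuallyEq_zero {k : Fin n} {z : EuclideanSpace ℂ (Fin n)} (hz : z ∉ S.region k) :
    S.plug k =ᶠ[𝓝 z] 0 := by
  by_cases hre : 0 < (z k).re
  · have ht := (S.contDiffAt_time hre).continuousAt
    have hN := (S.contDiffAt_sqSum hre).continuousAt
    have hτ := S.τ_pos
    have hc := S.c_pos
    have : S.τ ≤ |S.time k z| ∨ S.c ^ 4 ≤ S.sqSum k z := by
      by_contra! h
      exact hz ⟨hre, h⟩
    rcases this with h | h
    · filter_upwards [ht.abs.eventually (lt_mem_nhds (show 3 / 4 * S.τ < _ by linarith))] with w hw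
      by_contra h0
      exact absurd (S.of_plug_ne_zero h0).2.2.1 (not_le.2 hw)
    · filter_upwards [hN.eventually (lt_mem_nhds (show S.c ^ 4 / 2 < _ from
        (half_lt_self (by positivity)).trans_le h))] with w hw
      by_contra h0
      exact absurd (S.of_plug_ne_zero h0).2.1 (not_le.2 hw)
  · obtain ⟨m, hm, h⟩ := S.exists_le_re k
    have hc : Continuous fun z : EuclideanSpace ℂ (Fin n) => (z k).re :=
      Complex.continuous_re.comp (contDiff_coord k).continuous
    filter_upwards [hc.continuousAt.eventually (gt_mem_nhds (show _ < m from
      (not_lt.1 hre).trans_lt hm))] with w hw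
    by_contra h0
    obtain ⟨h1, h2, h3, h4⟩ := S.of_plug_ne_zero h0
    have h5 := (abs_le.1 h4).1
    have h6 := S.δ_le k
    exact absurd (h w (h3.trans (by linarith [S.τ_pos])) (S.sqSum_le_of_plug_ne_zero h0)
      (by linarith)) (not_le.2 hw)

lemma contDiff_plug (k : Fin n) : ContDiff ℝ (⊤ : ℕ∞) (S.plug k) := by
  rw [contDiff_iff_contDiffAt]
  intro z
  by_cases hz : z ∈ S.region k
  · refine ContDiffAt.congr_of_eventuallyEq ?_ (S.plug_eventuallyEq hz.1)
    exact S.profile.contDiff.contDiffAt.comp z ((S.contDiffAt_weighted hz.1).prodMk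
      ((S.contDiffAt_sqSum hz.1).prodMk ((S.contDiffAt_time hz.1).prodMk
        (S.contDiff_quad.contDiffAt.sub contDiffAt_const))))
  · exact ContDiffAt.congr_of_eventuallyEq contDiffAt_const (S.plug_eventuallyEq_zero hz)

lemma isOpen_region (k : Fin n) : IsOpen (S.region k) := by
  rw [isOpen_iff_mem_nhds]
  rintro z ⟨h1, h2, h3⟩
  filter_upwards [(isOpen_half k).mem_nhds h1,
    (S.contDiffAt_time h1).continuousAt.abs.eventually (gt_mem_nhds h2),
    (S.contDiffAt_sqSum h1).continuousAt.eventually (gt_mem_nhds h3)] with w hw1 hw2 hw3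
  exact ⟨hw1, hw2, hw3⟩

end PlugSystem

lemma gradient_eq_of_hasFDerivAt_innerSL {E : Type*} [NormedAddCommGroup E]
    [InnerProductSpace ℝ E] [CompleteSpace E] {f : E → ℝ} {v x : E}
    (h : HasFDerivAt f (innerSL ℝ v) x) : gradient f x = v :=
  HasGradientAt.gradient (hasGradientAt_iff_hasFDerivAt.2
    (h.congr_fderiv (ContinuousLinearMap.ext fun u => by simp)))

namespace PlugSystem

open Filter Topology

variable {n : ℕ} (S : PlugSystem n)

lemma gradient_ham_of_notMem {z : EuclideanSpace ℂ (Fin n)} (hz : ∀ k, z ∉ S.region k) (l : Fin n) :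
    gradient S.ham z l = 2 * S.a l * z l := by
  have h : HasFDerivAt S.ham (innerSL ℝ (∑ l, EuclideanSpace.single l (2 * S.a l * z l))) z := by
    refine (S.hasFDerivAt_quad z).congr_of_eventuallyEq ?_
    filter_upwards [eventually_all.2 fun k => S.plug_eventuallyEq_zero (hz k)] with w hw
    rw [ham, Finset.sum_eq_zero fun k _ => hw k, add_zero]
  rw [gradient_eq_of_hasFDerivAt_innerSL h]
  simp [Finset.sum_apply]

/-- The component of the gradient in the direction of the rotation in the `k`-th factor. -/
noncomputable def torque (k : Fin n) (z : EuclideanSpace ℂ (Fin n)) : ℝ :=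
  S.dF k z (0, 0, 1, 0) -
    ∑ l ∈ Finset.univ.erase k, S.speed k l z * (2 * S.a l * S.c * (S.rot k l z).im)

lemma gradient_ham {k : Fin n} {z : EuclideanSpace ℂ (Fin n)} (hz : 0 < (z k).re)
    (h : ∀ l, l ≠ k → z ∉ S.region l) :
    gradient S.ham z = (1 + S.dF k z (0, 0, 0, 1)) •
          ∑ l, EuclideanSpace.single l (2 * S.a l * z l) +
        ∑ l ∈ Finset.univ.erase k, S.speed k l z • EuclideanSpace.single l
          (z l - S.c * Complex.exp ((2 * S.a l * S.time k z : ℝ) * Complex.I)) +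
        S.torque k z • S.gradTime k z := by
  have he : S.ham =ᶠ[𝓝 z] fun z => S.quad z + S.F (S.coord k z) := by
    filter_upwards [eventually_all.2 fun l => eventually_imp_distrib_left.2 fun hl =>
      S.plug_eventuallyEq_zero (h l hl), S.plug_eventuallyEq hz] with w hw hw'
    rw [ham, ← Finset.add_sum_erase _ _ (Finset.mem_univ k), hw',
      Finset.sum_eq_zero fun l hl => hw l (Finset.ne_of_mem_erase hl), add_zero]
  have hd := ((S.hasFDerivAt_quad z).add
    (S.hasFDerivAt_F_comp_coord hz)).congr_of_eventuallyEq he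
  rw [← map_add] at hd
  rw [gradient_eq_of_hasFDerivAt_innerSL hd]
  simp only [gradAction, smul_sub, Finset.sum_sub_distrib, smul_smul, ← Finset.sum_smul, torque]
  module

lemma gradient_ham_apply_of_ne {k l : Fin n} {z : EuclideanSpace ℂ (Fin n)} (hz : 0 < (z k).re)
    (h : ∀ l, l ≠ k → z ∉ S.region l) (hl : l ≠ k) :
    gradient S.ham z l = (1 + S.dF k z (0, 0, 0, 1) : ℝ) * (2 * S.a l * z l) +
      S.speed k l z * (z l - S.c * Complex.exp ((2 * S.a l * S.time k z : ℝ) * Complex.I)) := by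
  rw [S.gradient_ham hz h]
  simp [Finset.sum_apply, gradTime, hl, Pi.single_apply]

lemma gradient_ham_apply_self {k : Fin n} {z : EuclideanSpace ℂ (Fin n)} (hz : 0 < (z k).re)
    (h : ∀ l, l ≠ k → z ∉ S.region l) :
    gradient S.ham z k = (1 + S.dF k z (0, 0, 0, 1) : ℝ) * (2 * S.a k * z k) +
      S.torque k z * (Complex.I * z k / (2 * S.a k * ‖z k‖ ^ 2 : ℝ)) := by
  rw [S.gradient_ham hz h]
  simp [Finset.sum_apply, gradTime, Pi.single_apply]

open Filter Topology

/-- The rate of the time coordinate along the orbits crossing the `k`-th plug. -/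
noncomputable def rate (k : Fin n) (z : EuclideanSpace ℂ (Fin n)) : ℝ :=
  1 + S.dF k z (0, 0, 0, 1)

lemma inner_gradTime_I_smul_gradient {k : Fin n} {z : EuclideanSpace ℂ (Fin n)}
    (hz : 0 < (z k).re) (h : ∀ l, l ≠ k → z ∉ S.region l) :
    ⟪S.gradTime k z, Complex.I • gradient S.ham z⟫ = S.rate k z := by
  rw [gradTime, inner_single_left_real, PiLp.smul_apply, S.gradient_ham_apply_self hz h, ← rate]
  have hn : (0 : ℝ) < Complex.normSq (z k) :=
    Complex.normSq_pos.2 fun h => by simp [h] at hz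
  have ha := S.a_pos k
  rw [← Complex.normSq_eq_norm_sq, Complex.div_ofReal_re, Complex.div_ofReal_im, smul_eq_mul,
    Complex.mul_re Complex.I (_ + _), Complex.mul_im Complex.I (_ + _), Complex.add_re,
    Complex.add_im, Complex.re_ofReal_mul (S.torque k z), Complex.im_ofReal_mul (S.torque k z),
    Complex.div_ofReal_re, Complex.div_ofReal_im]
  rw [Complex.normSq_apply] at hn ⊢
  simp
  field_simp
  ring

lemma inner_gradQuad_I_smul_gradient {k : Fin n} {z : EuclideanSpace ℂ (Fin n)}
    (hz : 0 < (z k).re) (h : ∀ l, l ≠ k → z ∉ S.region l) :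
    ⟪∑ l, EuclideanSpace.single l (2 * S.a l * z l), Complex.I • gradient S.ham z⟫ =
      -S.dF k z (0, 0, 1, 0) := by
  have hself : ⟪EuclideanSpace.single k (2 * S.a k * z k), Complex.I • gradient S.ham z⟫ =
      -S.torque k z := by
    rw [inner_single_left_real, PiLp.smul_apply, S.gradient_ham_apply_self hz h]
    have hn : (0 : ℝ) < Complex.normSq (z k) :=
      Complex.normSq_pos.2 fun h => by simp [h] at hz
    have ha := S.a_pos k
    rw [← Complex.normSq_eq_norm_sq, smul_eq_mul,
      Complex.mul_re Complex.I (_ + _), Complex.mul_im Complex.I (_ + _), Complex.add_re,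
      Complex.add_im, Complex.re_ofReal_mul (S.torque k z), Complex.im_ofReal_mul (S.torque k z),
      Complex.div_ofReal_re, Complex.div_ofReal_im]
    rw [Complex.normSq_apply] at hn ⊢
    simp
    field_simp
    ring
  have hne : ∀ l ∈ Finset.univ.erase k,
      ⟪EuclideanSpace.single l (2 * S.a l * z l), Complex.I • gradient S.ham z⟫ =
        -(S.speed k l z * (2 * S.a l * S.c * (S.rot k l z).im)) := by
    intro l hl
    rw [inner_single_left_real, PiLp.smul_apply,
      S.gradient_ham_apply_of_ne hz h (Finset.ne_of_mem_erase hl), rot_im]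
    generalize 2 * S.a l * S.time k z = θ
    rw [Complex.exp_mul_I, ← Complex.ofReal_cos, ← Complex.ofReal_sin]
    simp [Complex.cos_ofReal_re, Complex.sin_ofReal_re]
    ring
  rw [sum_inner, ← Finset.add_sum_erase _ _ (Finset.mem_univ k), hself, Finset.sum_congr rfl hne,
    Finset.sum_neg_distrib, torque]
  ring

lemma hasDerivAt_time {k : Fin n} {γ : ℝ → EuclideanSpace ℂ (Fin n)} {s : ℝ}
    (hγ : HasDerivAt γ (Complex.I • gradient S.ham (γ s)) s)
    (hz : 0 < (γ s k).re) (h : ∀ l, l ≠ k → γ s ∉ S.region l) :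
    HasDerivAt (fun s => S.time k (γ s)) (S.rate k (γ s)) s := by
  rw [← S.inner_gradTime_I_smul_gradient hz h]
  exact (S.hasFDerivAt_time hz).comp_hasDerivAt s hγ

lemma hasDerivAt_quad {k : Fin n} {γ : ℝ → EuclideanSpace ℂ (Fin n)} {s : ℝ}
    (hγ : HasDerivAt γ (Complex.I • gradient S.ham (γ s)) s)
    (hz : 0 < (γ s k).re) (h : ∀ l, l ≠ k → γ s ∉ S.region l) :
    HasDerivAt (fun s => S.quad (γ s)) (-S.dF k (γ s) (0, 0, 1, 0)) s := by
  rw [← S.inner_gradQuad_I_smul_gradient hz h]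
  exact (S.hasFDerivAt_quad _).comp_hasDerivAt s hγ

lemma hasDerivAt_coord {γ : ℝ → EuclideanSpace ℂ (Fin n)} {s : ℝ} {v : EuclideanSpace ℂ (Fin n)}
    (hγ : HasDerivAt γ v s) (l : Fin n) : HasDerivAt (fun s => γ s l) (v l) s :=
  (hasFDerivAt_coord l (γ s)).comp_hasDerivAt s hγ

lemma hasDerivAt_rot {k l : Fin n} {γ : ℝ → EuclideanSpace ℂ (Fin n)} {s : ℝ}
    (hγ : HasDerivAt γ (Complex.I • gradient S.ham (γ s)) s)
    (hz : 0 < (γ s k).re) (h : ∀ l, l ≠ k → γ s ∉ S.region l) (hl : l ≠ k) :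
    HasDerivAt (fun s => S.rot k l (γ s))
      (Complex.I * S.speed k l (γ s) * (S.rot k l (γ s) - S.c)) s := by
  have ht := ((((S.hasDerivAt_time hγ hz h).const_mul (2 * S.a l)).neg.ofReal_comp).mul_const
    Complex.I).cexp
  have hd := ht.fun_mul (hasDerivAt_coord hγ l)
  simp only [Pi.neg_apply, Complex.ofReal_neg] at hd
  refine hd.congr_deriv ?_
  rw [PiLp.smul_apply, S.gradient_ham_apply_of_ne hz h hl, smul_eq_mul, ← rate, rot]
  have he : Complex.exp (-(2 * S.a l * S.time k (γ s) : ℝ) * Complex.I) *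
      Complex.exp ((2 * S.a l * S.time k (γ s) : ℝ) * Complex.I) = 1 := by
    rw [← Complex.exp_add, neg_mul, neg_add_cancel, Complex.exp_zero]
  push_cast at he ⊢
  linear_combination (-Complex.I * S.speed k l (γ s) * S.c) * he

lemma gradient_ham_ne_zero {z : EuclideanSpace ℂ (Fin n)} (h1 : S.ham z = 1)
    (hn : 2 ≤ n) : gradient S.ham z ≠ 0 := by
  intro h0
  have hq := S.three_quarters_le_quad h1
  by_cases hz : ∀ k, z ∉ S.region k
  · refine absurd hq (not_le.2 ?_)
    have hz0 : ∀ l, z l = 0 := fun l => by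
      have := S.gradient_ham_of_notMem hz l
      simpa [h0, (S.a_pos l).ne'] using this.symm
    simp [quad, hz0]
  · push Not at hz
    obtain ⟨k, hk⟩ := hz
    have hdisj : ∀ l, l ≠ k → z ∉ S.region l := fun l hl hzl => by
      linarith [S.quad_le_of_mem_inter hl hk hzl]
    have hrate : S.rate k z = 0 := by
      rw [← S.inner_gradTime_I_smul_gradient hk.1 hdisj, h0, smul_zero, inner_zero_right]
    obtain ⟨hN, ht, hr⟩ := S.profile.core_of_speed_eq_zero _ _ _ _ (S.abs_weighted_le hk.2.2.le)
      hrate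
    have hact : ∀ l, l ≠ k → S.action k l z = 0 := fun l hl => by
      have := S.action_sq_le_sqSum hl z
      rw [hN] at this
      exact pow_eq_zero_iff two_ne_zero |>.1 (le_antisymm this (sq_nonneg _))
    have : Nontrivial (Fin n) := Fin.nontrivial_iff_two_le.2 hn
    obtain ⟨l, hl⟩ := exists_ne k
    have hA : S.weighted k z = 0 :=
      Finset.sum_eq_zero fun j hj => by rw [hact j (Finset.ne_of_mem_erase hj), mul_zero]
    have hspeed : S.speed k l z ≠ 0 := by
      have := S.profile.fderiv_A_core _ ht
      rw [speed, hact l hl, dF, coord, hA, hN, hr]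
      simpa using ⟨this, (S.a_pos l).ne'⟩
    have hg := S.gradient_ham_apply_of_ne hk.1 hdisj hl
    rw [← rate, hrate, h0] at hg
    have hg' : z l = S.c * Complex.exp ((2 * S.a l * S.time k z : ℝ) * Complex.I) := by
      simpa [hspeed, sub_eq_zero] using hg
    have hrot : S.rot k l z = S.c := by
      rw [rot, hg', mul_left_comm, ← Complex.exp_add]
      simp
    have := S.two_mul_action k l z
    rw [hact l hl, hrot] at this
    simp [S.c_pos.ne'] at this

end PlugSystem

lemma eqOn_Icc_of_hasDerivAt {E : Type*} [NormedAddCommGroup E] [NormedSpace ℝ E] {v : E → E}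
    {K : NNReal} (hv : LipschitzWith K v) {f g : ℝ → E} {a b : ℝ}
    (hf : ∀ s ∈ Set.Icc a b, HasDerivAt f (v (f s)) s)
    (hg : ∀ s ∈ Set.Icc a b, HasDerivAt g (v (g s)) s) (h : f a = g a) :
    Set.EqOn f g (Set.Icc a b) := by
  intro s hs
  have := dist_le_of_trajectories_ODE (v := fun _ => v) (δ := 0) (fun _ => hv)
    (fun s hs => (hf s hs).continuousAt.continuousWithinAt)
    (fun s hs => (hf s (Set.Ico_subset_Icc_self hs)).hasDerivWithinAt)
    (fun s hs => (hg s hs).continuousAt.continuousWithinAt)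
    (fun s hs => (hg s (Set.Ico_subset_Icc_self hs)).hasDerivWithinAt) (by rw [h, dist_self]) s hs
  rw [zero_mul] at this
  exact dist_le_zero.1 this

lemma eq_of_hasDerivAt_zero {E : Type*} [NormedAddCommGroup E] [NormedSpace ℝ E] {f : ℝ → E}
    {a b : ℝ} (hf : ∀ s ∈ Set.Icc a b, HasDerivAt f 0 s) {s t : ℝ} (hs : s ∈ Set.Icc a b)
    (ht : t ∈ Set.Icc a b) : f s = f t := by
  have := constant_of_has_deriv_right_zero
    (fun s hs => (hf s hs).continuousAt.continuousWithinAt)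
    (fun s hs => (hf s (Set.Ico_subset_Icc_self hs)).hasDerivWithinAt)
  rw [this s hs, this t ht]

namespace IsPlugProfile

variable {δ τ η M : ℝ} {F : ℝ × ℝ × ℝ × ℝ → ℝ}

/-- The Hamiltonian vector field of the profile with frozen actions. -/
noncomputable def field (F : ℝ × ℝ × ℝ × ℝ → ℝ) (A N : ℝ) (x : ℝ × ℝ) : ℝ × ℝ :=
  (1 + fderiv ℝ F (A, N, x) (0, 0, 0, 1), -fderiv ℝ F (A, N, x) (0, 0, 1, 0))

lemma fderiv_apply_slice (hF : IsPlugProfile δ τ η M F) (A N : ℝ) (x v : ℝ × ℝ) :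
    fderiv ℝ F (A, N, x) (0, 0, v) = fderiv ℝ (fun x => F (A, N, x)) x v := by
  have hd : HasFDerivAt F (fderiv ℝ F (A, N, x)) (A, N, x) :=
    (hF.contDiff.differentiable (by simp) _).hasFDerivAt
  have := HasFDerivAt.comp (g := F) (f := fun x => (A, N, x)) x hd
    ((hasFDerivAt_const A x).prodMk ((hasFDerivAt_const N x).prodMk
    (hasFDerivAt_id x)))
  rw [HasFDerivAt.fderiv (f := fun x => F (A, N, x)) this]
  simp

lemma exists_lipschitzWith_field (hF : IsPlugProfile δ τ η M F) (A N : ℝ) :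
    ∃ K, LipschitzWith K (field F A N) := by
  set G : ℝ × ℝ → ℝ := fun x => F (A, N, x) with hG
  have hGc : ContDiff ℝ (⊤ : ℕ∞) G := hF.contDiff.comp (by fun_prop)
  have hGs : HasCompactSupport G := by
    refine HasCompactSupport.of_support_subset_isCompact
      (isCompact_Icc (a := (-(3 / 4 * τ), -(δ / 2))) (b := (3 / 4 * τ, δ / 2))) fun x hx => ?_
    obtain ⟨-, ht, hr⟩ := hF.support A N x.1 x.2 hx
    exact ⟨⟨(_root_.abs_le.1 ht).1, (_root_.abs_le.1 hr).1⟩,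
      ⟨(_root_.abs_le.1 ht).2, (_root_.abs_le.1 hr).2⟩⟩
  have key : ∀ v, ∃ K, LipschitzWith K fun x => fderiv ℝ F (A, N, x) (0, 0, v) := by
    intro v
    simp_rw [hF.fderiv_apply_slice]
    refine ContDiff.lipschitzWith_of_hasCompactSupport (𝕂 := ℝ) (n := 1)
      (hGs.fderiv_apply ℝ v) ?_ one_ne_zero
    exact (hGc.fderiv_right (m := 1) (by norm_cast)).clm_apply contDiff_const
  obtain ⟨K, hK⟩ := key (0, 1)
  obtain ⟨L, hL⟩ := key (1, 0)
  exact ⟨_, ((LipschitzWith.const 1).add hK).prodMk hL.neg⟩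

lemma field_neg (hF : IsPlugProfile δ τ η M F) (A N : ℝ) (x : ℝ × ℝ) :
    field F A N (-x) = field F A N x := by
  have key : ∀ v, fderiv ℝ F (A, N, -x) (0, 0, v) = fderiv ℝ F (A, N, x) (0, 0, v) := by
    intro v
    rw [hF.fderiv_apply_slice, hF.fderiv_apply_slice]
    have h : (fun x : ℝ × ℝ => F (A, N, x)) = fun x => -F (A, N, -x) := by
      funext x
      rw [← neg_eq_iff_eq_neg]
      exact (hF.odd A N x.1 x.2).symm
    have hd : HasFDerivAt (fun x : ℝ × ℝ => F (A, N, x))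
        (fderiv ℝ (fun x => F (A, N, x)) (-x)) (-x) :=
      ((hF.contDiff.comp (f := fun x : ℝ × ℝ => (A, N, x)) (by fun_prop)).differentiable
        (by simp) _).hasFDerivAt
    have := (hd.comp x (hasFDerivAt_id x).neg).neg
    have h2 : fderiv ℝ (fun x => F (A, N, x)) x = _ :=
      (this.congr_of_eventuallyEq (f₁ := fun x => F (A, N, x))
        (Filter.Eventually.of_forall (congrFun h))).fderiv
    rw [h2]
    simp
  rw [field, field, key, key]

lemma fderiv_fst_neg (hF : IsPlugProfile δ τ η M F) (A N : ℝ) (x : ℝ × ℝ) (p q : ℝ) :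
    fderiv ℝ F (A, N, -x) (p, q, 0) = -fderiv ℝ F (A, N, x) (p, q, 0) := by
  have hd : ∀ y, HasFDerivAt (fun w : ℝ × ℝ => F (w.1, w.2, y))
      ((fderiv ℝ F (A, N, y)).comp ((ContinuousLinearMap.fst ℝ ℝ ℝ).prod
        ((ContinuousLinearMap.snd ℝ ℝ ℝ).prod 0))) (A, N) := fun y =>
    HasFDerivAt.comp (g := F) (A, N) (hF.contDiff.differentiable (by simp) (A, N, y)).hasFDerivAt
      (hasFDerivAt_fst.prodMk (hasFDerivAt_snd.prodMk (hasFDerivAt_const y _)))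
  have h : (fun w : ℝ × ℝ => F (w.1, w.2, -x)) = fun w => -F (w.1, w.2, x) := by
    funext w
    exact hF.odd w.1 w.2 x.1 x.2
  have h1 := hd (-x)
  rw [h] at h1
  have := congrArg (fun D => D (p, q)) (h1.unique (hd x).neg)
  simpa using this

lemma eq_zero_of_lt_abs (hF : IsPlugProfile δ τ η M F) {A N t r : ℝ} (h : 3 / 4 * τ < |t|) :
    F (A, N, t, r) = 0 :=
  by_contra fun h0 => absurd (hF.support A N t r h0).2.1 (not_le.2 h)

end IsPlugProfile

lemma norm_eq_of_hasDerivAt_I_mul {f : ℝ → ℂ} {ω : ℝ → ℝ} {a b : ℝ}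
    (hf : ∀ s ∈ Set.Icc a b, HasDerivAt f (Complex.I * ω s * f s) s) {s t : ℝ}
    (hs : s ∈ Set.Icc a b) (ht : t ∈ Set.Icc a b) : ‖f s‖ = ‖f t‖ := by
  have h : ‖f s‖ ^ 2 = ‖f t‖ ^ 2 := by
    refine eq_of_hasDerivAt_zero (f := fun s => ‖f s‖ ^ 2)
      (fun s hs => (hf s hs).norm_sq.congr_deriv ?_) hs ht
    rw [Complex.inner]
    simp
    ring
  exact (sq_eq_sq₀ (norm_nonneg _) (norm_nonneg _)).1 h

namespace PlugSystem

open Filter Topology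

variable {n : ℕ} (S : PlugSystem n)

/-- Orbits of the perturbed Hamiltonian on the level `1`. -/
structure IsOrbit (γ : ℝ → EuclideanSpace ℂ (Fin n)) : Prop where
  hasDerivAt : ∀ s, HasDerivAt γ (Complex.I • gradient S.ham (γ s)) s
  level : ∀ s, S.ham (γ s) = 1

/-- The points of the right half space of the `k`-th factor outside of the other plugs. -/
def tube (k : Fin n) : Set (EuclideanSpace ℂ (Fin n)) :=
  {z | 0 < (z k).re ∧ ∀ l, l ≠ k → z ∉ S.region l}

/-- The coordinates of a point in the plane of time and energy. -/
noncomputable def plane (k : Fin n) (z : EuclideanSpace ℂ (Fin n)) : ℝ × ℝ :=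
  (S.time k z, S.quad z - 1)

variable {S} {γ : ℝ → EuclideanSpace ℂ (Fin n)} {k : Fin n} {a b : ℝ}

namespace IsOrbit

lemma continuous (hγ : S.IsOrbit γ) : Continuous γ :=
  continuous_iff_continuousAt.2 fun s => (hγ.hasDerivAt s).continuousAt

lemma mem_tube (hγ : S.IsOrbit γ) {z : ℝ} (h : γ z ∈ S.region k) : γ z ∈ S.tube k :=
  ⟨h.1, fun l hl hzl => by
    linarith [S.quad_le_of_mem_inter hl h hzl, S.three_quarters_le_quad (hγ.level z)]⟩

lemma add_F_eq_zero (hγ : S.IsOrbit γ) {s : ℝ} (hs : γ s ∈ S.tube k) :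
    S.quad (γ s) - 1 + S.F (S.coord k (γ s)) = 0 := by
  have h := hγ.level s
  rw [ham, ← Finset.add_sum_erase _ _ (Finset.mem_univ k), plug, if_pos hs.1,
    Finset.sum_eq_zero fun l hl => ?_] at h
  · linarith
  · exact (S.plug_eventuallyEq_zero (hs.2 l (Finset.ne_of_mem_erase hl))).eq_of_nhds

lemma action_eq (hγ : S.IsOrbit γ) (h : ∀ s ∈ Set.Icc a b, γ s ∈ S.tube k)
    {l : Fin n} (hl : l ≠ k) {s t : ℝ} (hs : s ∈ Set.Icc a b) (ht : t ∈ Set.Icc a b) :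
    S.action k l (γ s) = S.action k l (γ t) := by
  have := norm_eq_of_hasDerivAt_I_mul (f := fun s => S.rot k l (γ s) - S.c)
    (ω := fun s => S.speed k l (γ s)) (fun s hs =>
      (S.hasDerivAt_rot (hγ.hasDerivAt s) (h s hs).1 (h s hs).2 hl).sub_const _) hs ht
  have h1 := S.two_mul_action k l (γ s)
  have h2 := S.two_mul_action k l (γ t)
  rw [this] at h1
  linarith

lemma weighted_eq (hγ : S.IsOrbit γ) (h : ∀ s ∈ Set.Icc a b, γ s ∈ S.tube k)
    {s t : ℝ} (hs : s ∈ Set.Icc a b) (ht : t ∈ Set.Icc a b) :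
    S.weighted k (γ s) = S.weighted k (γ t) :=
  Finset.sum_congr rfl fun l hl => by rw [hγ.action_eq h (Finset.ne_of_mem_erase hl) hs ht]

lemma sqSum_eq (hγ : S.IsOrbit γ) (h : ∀ s ∈ Set.Icc a b, γ s ∈ S.tube k)
    {s t : ℝ} (hs : s ∈ Set.Icc a b) (ht : t ∈ Set.Icc a b) :
    S.sqSum k (γ s) = S.sqSum k (γ t) :=
  Finset.sum_congr rfl fun l hl => by rw [hγ.action_eq h (Finset.ne_of_mem_erase hl) hs ht]

lemma hasDerivAt_plane (hγ : S.IsOrbit γ) (h : ∀ s ∈ Set.Icc a b, γ s ∈ S.tube k)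
    {s t : ℝ} (hs : s ∈ Set.Icc a b) (ht : t ∈ Set.Icc a b) :
    HasDerivAt (fun s => S.plane k (γ s)) (IsPlugProfile.field S.F (S.weighted k (γ t))
      (S.sqSum k (γ t)) (S.plane k (γ s))) s := by
  rw [← hγ.weighted_eq h hs ht, ← hγ.sqSum_eq h hs ht]
  exact (S.hasDerivAt_time (hγ.hasDerivAt s) (h s hs).1 (h s hs).2).prodMk
    ((S.hasDerivAt_quad (hγ.hasDerivAt s) (h s hs).1 (h s hs).2).sub_const 1)

lemma monotoneOn_time (hγ : S.IsOrbit γ) (h : ∀ s ∈ Set.Icc a b, γ s ∈ S.tube k)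
    (hN : ∀ s ∈ Set.Icc a b, S.sqSum k (γ s) ≤ S.c ^ 4) :
    MonotoneOn (fun s => S.time k (γ s)) (Set.Icc a b) := by
  have hd : ∀ s ∈ Set.Icc a b, HasDerivAt (fun s => S.time k (γ s)) (S.rate k (γ s)) s :=
    fun s hs => S.hasDerivAt_time (hγ.hasDerivAt s) (h s hs).1 (h s hs).2
  exact monotoneOn_of_hasDerivWithinAt_nonneg (convex_Icc a b)
    (fun s hs => (hd s hs).continuousAt.continuousWithinAt)
    (fun s hs => (hd s (interior_subset hs)).hasDerivWithinAt)
    (fun s hs => S.profile.speed_nonneg _ _ _ _ (S.abs_weighted_le (hN s (interior_subset hs))))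

end IsOrbit

/-- A maximal passage of an orbit through the region of the `k`-th plug. -/
structure IsPassage (S : PlugSystem n) (γ : ℝ → EuclideanSpace ℂ (Fin n)) (k : Fin n) (a b : ℝ) :
    Prop where
  lt : a < b
  mem : ∀ s ∈ Set.Ioo a b, γ s ∈ S.region k
  left_notMem : ∀ l, γ a ∉ S.region l
  right_notMem : ∀ l, γ b ∉ S.region l

namespace IsPassage

lemma le_re (hp : IsPassage S γ k a b) (hγ : S.IsOrbit γ) {m : ℝ}
    (hm : ∀ z, |S.time k z| ≤ S.τ → S.sqSum k z ≤ S.c ^ 4 → 3 / 4 ≤ S.quad z → m ≤ (z k).re)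
    {s : ℝ} (hs : s ∈ Set.Icc a b) : m ≤ (γ s k).re := by
  have hc : IsClosed {s | m ≤ (γ s k).re} :=
    isClosed_le continuous_const
      (Complex.continuous_re.comp ((contDiff_coord k).continuous.comp hγ.continuous))
  have hsub : Set.Ioo a b ⊆ {s | m ≤ (γ s k).re} := fun s hs =>
    hm _ (hp.mem s hs).2.1.le (hp.mem s hs).2.2.le (S.three_quarters_le_quad (hγ.level s))
  rw [← closure_Ioo hp.lt.ne] at hs
  exact hc.closure_subset_iff.2 hsub hs

lemma mem_tube (hp : IsPassage S γ k a b) (hγ : S.IsOrbit γ) {s : ℝ} (hs : s ∈ Set.Icc a b) :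
    γ s ∈ S.tube k := by
  obtain ⟨m, hm0, hm⟩ := S.exists_le_re k
  refine ⟨hm0.trans_le (hp.le_re hγ hm hs), fun l hl => ?_⟩
  rcases hs.1.eq_or_lt with rfl | ha
  · exact hp.left_notMem l
  rcases hs.2.eq_or_lt with rfl | hb
  · exact hp.right_notMem l
  exact (hγ.mem_tube (hp.mem s ⟨ha, hb⟩)).2 l hl

lemma sqSum_lt (hp : IsPassage S γ k a b) (hγ : S.IsOrbit γ) {s : ℝ} (hs : s ∈ Set.Icc a b) :
    S.sqSum k (γ s) < S.c ^ 4 := by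
  obtain ⟨t, ht⟩ := Set.nonempty_Ioo.2 hp.lt
  rw [hγ.sqSum_eq (fun _ => hp.mem_tube hγ) hs (Set.Ioo_subset_Icc_self ht)]
  exact (hp.mem t ht).2.2

lemma monotoneOn_time (hp : IsPassage S γ k a b) (hγ : S.IsOrbit γ) :
    MonotoneOn (fun s => S.time k (γ s)) (Set.Icc a b) :=
  hγ.monotoneOn_time (fun _ => hp.mem_tube hγ) fun _ hs => (hp.sqSum_lt hγ hs).le

lemma continuousOn_time (hp : IsPassage S γ k a b) (hγ : S.IsOrbit γ) :
    ContinuousOn (fun s => S.time k (γ s)) (Set.Icc a b) := fun _ hs =>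
  (S.hasDerivAt_time (hγ.hasDerivAt _) (hp.mem_tube hγ hs).1
    (hp.mem_tube hγ hs).2).continuousAt.continuousWithinAt

lemma abs_time_le (hp : IsPassage S γ k a b) (hγ : S.IsOrbit γ) {s : ℝ} (hs : s ∈ Set.Icc a b) :
    |S.time k (γ s)| ≤ S.τ := by
  have hc := ((hp.continuousOn_time hγ).abs s hs).mono Set.Ioo_subset_Icc_self
  rw [← closure_Ioo hp.lt.ne] at hs
  exact ContinuousWithinAt.closure_le hs hc continuousWithinAt_const
    fun s hs => (hp.mem s hs).2.1.le

lemma abs_time_eq (hp : IsPassage S γ k a b) (hγ : S.IsOrbit γ) {s : ℝ} (hs : s ∈ Set.Icc a b)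
    (h : γ s ∉ S.region k) : |S.time k (γ s)| = S.τ :=
  le_antisymm (hp.abs_time_le hγ hs) (not_lt.1 fun hlt =>
    h ⟨(hp.mem_tube hγ hs).1, hlt, hp.sqSum_lt hγ hs⟩)

lemma quad_eq_one (hp : IsPassage S γ k a b) (hγ : S.IsOrbit γ) {s : ℝ} (hs : s ∈ Set.Icc a b)
    (h : γ s ∉ S.region k) : S.quad (γ s) - 1 = 0 := by
  have h1 := hγ.add_F_eq_zero (hp.mem_tube hγ hs)
  rwa [coord, S.profile.eq_zero_of_lt_abs, add_zero] at h1
  rw [hp.abs_time_eq hγ hs h]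
  linarith [S.τ_pos]

lemma plane_left (hp : IsPassage S γ k a b) (hγ : S.IsOrbit γ) :
    S.plane k (γ a) = (-S.τ, 0) := by
  have ha := Set.left_mem_Icc.2 hp.lt.le
  rw [plane, hp.quad_eq_one hγ ha (hp.left_notMem k)]
  rcases eq_or_eq_neg_of_abs_eq (hp.abs_time_eq hγ ha (hp.left_notMem k)) with h | h
  · obtain ⟨t, ht⟩ := Set.nonempty_Ioo.2 hp.lt
    have h1 := hp.monotoneOn_time hγ ha (Set.Ioo_subset_Icc_self ht) ht.1.le
    have h2 := (abs_lt.1 (hp.mem t ht).2.1).2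
    simp only at h1
    linarith
  · rw [h]

lemma plane_right (hp : IsPassage S γ k a b) (hγ : S.IsOrbit γ) :
    S.plane k (γ b) = (S.τ, 0) := by
  have hb := Set.right_mem_Icc.2 hp.lt.le
  rw [plane, hp.quad_eq_one hγ hb (hp.right_notMem k)]
  rcases eq_or_eq_neg_of_abs_eq (hp.abs_time_eq hγ hb (hp.right_notMem k)) with h | h
  · rw [h]
  · obtain ⟨t, ht⟩ := Set.nonempty_Ioo.2 hp.lt
    have h1 := hp.monotoneOn_time hγ (Set.Ioo_subset_Icc_self ht) hb ht.2.le
    have h2 := (abs_lt.1 (hp.mem t ht).2.1).1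
    simp only at h1
    linarith

lemma reflect_mem {s : ℝ} (hs : s ∈ Set.Icc a b) : a + b - s ∈ Set.Icc a b :=
  ⟨by linarith [hs.2], by linarith [hs.1]⟩

lemma plane_reflect (hp : IsPassage S γ k a b) (hγ : S.IsOrbit γ) {s : ℝ}
    (hs : s ∈ Set.Icc a b) : S.plane k (γ (a + b - s)) = -S.plane k (γ s) := by
  have ha := Set.left_mem_Icc.2 hp.lt.le
  obtain ⟨K, hK⟩ := S.profile.exists_lipschitzWith_field (S.weighted k (γ a)) (S.sqSum k (γ a))
  have hd := fun s hs => hγ.hasDerivAt_plane (fun _ => hp.mem_tube hγ) (s := s) hs ha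
  refine neg_eq_iff_eq_neg.1 (eqOn_Icc_of_hasDerivAt hK
    (f := fun s => -S.plane k (γ (a + b - s))) (fun s hs => ?_) hd ?_ hs)
  · rw [S.profile.field_neg]
    have := (hd _ (reflect_mem hs)).scomp s ((hasDerivAt_id s).const_sub (a + b))
    exact this.neg.congr_deriv (by simp)
  · simp [hp.plane_left hγ, hp.plane_right hγ]

lemma speed_reflect (hp : IsPassage S γ k a b) (hγ : S.IsOrbit γ) {l : Fin n} (hl : l ≠ k) {s : ℝ}
    (hs : s ∈ Set.Icc a b) : S.speed k l (γ (a + b - s)) = -S.speed k l (γ s) := by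
  have h := fun s => hp.mem_tube hγ (s := s)
  have hc : S.coord k (γ (a + b - s)) =
      (S.weighted k (γ s), S.sqSum k (γ s), -S.plane k (γ s)) := by
    rw [← hp.plane_reflect hγ hs, ← hγ.weighted_eq h (reflect_mem hs) hs,
      ← hγ.sqSum_eq h (reflect_mem hs) hs]
    rfl
  have hF : ∀ p q, S.dF k (γ (a + b - s)) (p, q, 0, 0) = -S.dF k (γ s) (p, q, 0, 0) := by
    intro p q
    rw [dF, hc]
    exact S.profile.fderiv_fst_neg _ _ _ p q
  rw [speed, speed, hγ.action_eq h hl (reflect_mem hs) hs, hF, hF]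
  ring

lemma rot_right (hp : IsPassage S γ k a b) (hγ : S.IsOrbit γ) {l : Fin n} (hl : l ≠ k) :
    S.rot k l (γ b) = S.rot k l (γ a) := by
  have ha := Set.left_mem_Icc.2 hp.lt.le
  have hd : ∀ s ∈ Set.Icc a b, HasDerivAt (fun s => S.rot k l (γ s)) _ s := fun s hs =>
    S.hasDerivAt_rot (hγ.hasDerivAt s) (hp.mem_tube hγ hs).1 (hp.mem_tube hγ hs).2 hl
  have hmid : (a + b) / 2 ∈ Set.Icc a b := ⟨by linarith [hp.lt], by linarith [hp.lt]⟩
  have := norm_eq_of_hasDerivAt_I_mul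
    (f := fun s => S.rot k l (γ (a + b - s)) - S.rot k l (γ s))
    (ω := fun s => S.speed k l (γ s)) (fun s hs => ?_) ha hmid
  · simp only [show a + b - (a + b) / 2 = (a + b) / 2 by ring, sub_self, norm_zero,
      norm_eq_zero, sub_eq_zero] at this
    rwa [show a + b - a = b by ring] at this
  · have h1 := (hd _ (reflect_mem hs)).scomp s ((hasDerivAt_id s).const_sub (a + b))
    refine (h1.sub (hd s hs)).congr_deriv ?_
    rw [hp.speed_reflect hγ hl hs]
    simp
    ring

lemma exists_left_ne_zero (hp : IsPassage S γ k a b) (hγ : S.IsOrbit γ) :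
    ∃ l, l ≠ k ∧ γ a l ≠ 0 := by
  by_contra! h0
  have h := fun s => hp.mem_tube hγ (s := s)
  have ha := Set.left_mem_Icc.2 hp.lt.le
  have hb := Set.right_mem_Icc.2 hp.lt.le
  have hact : ∀ l ∈ Finset.univ.erase k, S.action k l (γ a) = 0 := fun l hl => by
    simp [action, rot, h0 l (Finset.ne_of_mem_erase hl)]
  have hA : S.weighted k (γ a) = 0 := Finset.sum_eq_zero fun l hl => by simp [hact l hl]
  have hN : S.sqSum k (γ a) = 0 := Finset.sum_eq_zero fun l hl => by simp [hact l hl]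
  have hτ := S.τ_pos
  obtain ⟨s, hs, hst⟩ := intermediate_value_Icc hp.lt.le (hp.continuousOn_time hγ)
    (show -(S.τ / 2) ∈ _ by
      have h1 := congrArg Prod.fst (hp.plane_left hγ)
      have h2 := congrArg Prod.fst (hp.plane_right hγ)
      simp only [plane] at h1 h2
      simp only [h1, h2]
      constructor <;> linarith)
  simp only at hst
  have hr : S.quad (γ s) - 1 = 0 := by
    refine S.profile.eq_zero_of_level (-(S.τ / 2)) _ ?_
    have h1 := hγ.add_F_eq_zero (h s hs)
    rwa [coord, hγ.weighted_eq h hs ha, hγ.sqSum_eq h hs ha, hA, hN, hst] at h1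
  obtain ⟨K, hK⟩ := S.profile.exists_lipschitzWith_field 0 0
  have hsub : Set.Icc s b ⊆ Set.Icc a b := Set.Icc_subset_Icc_left hs.1
  have heq := eqOn_Icc_of_hasDerivAt hK (f := fun s => S.plane k (γ s))
    (g := fun _ => (-(S.τ / 2), 0)) (a := s) (b := b) (fun t ht => ?_) (fun t ht => ?_) ?_
    (Set.right_mem_Icc.2 hs.2)
  · have := congrArg Prod.fst heq
    simp only [hp.plane_right hγ] at this
    linarith
  · have := hγ.hasDerivAt_plane h (hsub ht) ha
    rwa [hA, hN] at this
  · have : IsPlugProfile.field S.F 0 0 (-(S.τ / 2), 0) = 0 := by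
      rw [IsPlugProfile.field, S.profile.speed_core, S.profile.fderiv_t_core]
      simp
    rw [this]
    exact hasDerivAt_const t _
  · simp [plane, hst, hr]

end IsPassage

end PlugSystem

lemma eq_exp_mul_of_hasDerivAt {f : ℝ → ℂ} {ω a b : ℝ} (hab : a ≤ b)
    (hf : ∀ s ∈ Set.Icc a b, HasDerivAt f (Complex.I * ω * f s) s) :
    f b = Complex.exp ((ω * (b - a) : ℝ) * Complex.I) * f a := by
  have h := eq_of_hasDerivAt_zero
    (f := fun s => Complex.exp ((ω * (b - s) : ℝ) * Complex.I) * f s) (fun s hs => ?_)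
    (Set.left_mem_Icc.2 hab) (Set.right_mem_Icc.2 hab)
  · simpa using h.symm
  · have h1 := (((((hasDerivAt_id s).const_sub b).const_mul ω).ofReal_comp).mul_const
      Complex.I).cexp
    refine (h1.fun_mul (hf s hs)).congr_deriv ?_
    push_cast
    simp
    ring

namespace PlugSystem

open Filter Topology

variable {n : ℕ} {S : PlugSystem n} {γ : ℝ → EuclideanSpace ℂ (Fin n)} {k : Fin n} {a b : ℝ}

/-- The flow of the unperturbed Hamiltonian. -/
noncomputable def flow (S : PlugSystem n) (θ : ℝ) (z : EuclideanSpace ℂ (Fin n)) :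
    EuclideanSpace ℂ (Fin n) :=
  WithLp.toLp 2 fun l => Complex.exp ((2 * S.a l * θ : ℝ) * Complex.I) * z l

lemma flow_zero (z : EuclideanSpace ℂ (Fin n)) : S.flow 0 z = z := by
  ext l
  simp [flow]

lemma flow_flow (θ φ : ℝ) (z : EuclideanSpace ℂ (Fin n)) :
    S.flow θ (S.flow φ z) = S.flow (θ + φ) z := by
  ext l
  simp only [flow, ← mul_assoc, ← Complex.exp_add]
  congr 2
  push_cast
  ring

namespace IsPassage

lemma norm_right (hp : IsPassage S γ k a b) (hγ : S.IsOrbit γ) (l : Fin n) :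
    ‖γ b l‖ = ‖γ a l‖ := by
  have hne : ∀ l, l ≠ k → ‖γ b l‖ = ‖γ a l‖ := fun l hl => by
    rw [← S.norm_rot k, hp.rot_right hγ hl, norm_rot]
  by_cases hl : l = k
  · subst hl
    have hq : S.quad (γ b) = S.quad (γ a) := by
      linarith [hp.quad_eq_one hγ (Set.left_mem_Icc.2 hp.lt.le) (hp.left_notMem l),
        hp.quad_eq_one hγ (Set.right_mem_Icc.2 hp.lt.le) (hp.right_notMem l)]
    rw [quad, quad, ← Finset.add_sum_erase _ _ (Finset.mem_univ l),
      ← Finset.add_sum_erase Finset.univ (fun l => S.a l * ‖γ a l‖ ^ 2) (Finset.mem_univ l),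
      Finset.sum_congr rfl fun j hj => by rw [hne j (Finset.ne_of_mem_erase hj)],
      add_left_inj, mul_right_inj' (S.a_pos l).ne'] at hq
    exact (sq_eq_sq₀ (norm_nonneg _) (norm_nonneg _)).1 hq
  · exact hne l hl

lemma right_eq_flow (hp : IsPassage S γ k a b) (hγ : S.IsOrbit γ) :
    γ b = S.flow (2 * S.τ) (γ a) := by
  have ht1 : S.time k (γ a) = -S.τ := congrArg Prod.fst (hp.plane_left hγ)
  have ht2 : S.time k (γ b) = S.τ := congrArg Prod.fst (hp.plane_right hγ)
  ext l
  simp only [flow]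
  by_cases hl : l = k
  · subst hl
    rw [← Complex.norm_mul_exp_arg_mul_I (γ b l), ← Complex.norm_mul_exp_arg_mul_I (γ a l),
      ← S.two_mul_a_mul_time, ← S.two_mul_a_mul_time, ht1, ht2, hp.norm_right hγ, mul_left_comm,
      ← Complex.exp_add]
    congr 2
    push_cast
    ring
  · have h := hp.rot_right hγ hl
    rw [rot, rot, ht1, ht2] at h
    calc γ b l = Complex.exp ((2 * S.a l * S.τ : ℝ) * Complex.I) *
          (Complex.exp (-(2 * S.a l * S.τ : ℝ) * Complex.I) * γ b l) := by
            rw [← mul_assoc, ← Complex.exp_add]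
            simp
      _ = _ := by
        rw [h, ← mul_assoc, ← Complex.exp_add]
        congr 2
        push_cast
        ring

/-- The time needed for a passage is bounded below on bounded time intervals. -/
lemma exists_le_sub (hγ : S.IsOrbit γ) (s₀ s₁ : ℝ) : ∃ ℓ > 0, ∀ k a b, IsPassage S γ k a b →
    a ∈ Set.Icc s₀ s₁ → b ∈ Set.Icc s₀ s₁ → ℓ ≤ b - a := by
  have huc := Metric.uniformContinuousOn_iff.1
    (isCompact_Icc.uniformContinuousOn_of_continuous
      (hγ.continuous.continuousOn (s := Set.Icc s₀ s₁)))
  have key : ∀ k, ∃ ℓ > 0, ∀ a b, IsPassage S γ k a b →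
      a ∈ Set.Icc s₀ s₁ → b ∈ Set.Icc s₀ s₁ → ℓ ≤ b - a := by
    intro k
    obtain ⟨m, hm0, hm⟩ := S.exists_le_re k
    set u : ℂ := Complex.exp ((2 * S.a k * (2 * S.τ) : ℝ) * Complex.I) with hu
    have hu1 : u ≠ 1 := by
      intro h
      have hc := congrArg Complex.re h
      rw [hu, Complex.exp_ofReal_mul_I_re, Complex.one_re] at hc
      have h1 := mul_pos (S.a_pos k) S.τ_pos
      have h2 := S.two_mul_a_mul_τ_le k
      rw [Real.cos_eq_one_iff_of_lt_of_lt (by linarith [Real.pi_gt_three])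
        (by linarith [Real.pi_gt_three])] at hc
      linarith
    obtain ⟨ℓ, hℓ, h⟩ := huc (‖u - 1‖ * m) (mul_pos (norm_pos_iff.2 (sub_ne_zero.2 hu1)) hm0)
    refine ⟨ℓ, hℓ, fun a b hp ha hb => not_lt.1 fun hlt => ?_⟩
    have h1 := h b hb a ha (by rwa [Real.dist_eq, abs_of_pos (sub_pos.2 hp.lt)])
    have h2 : ‖(u - 1) * γ a k‖ ≤ dist (γ b) (γ a) := by
      have h3 := congrArg (fun z : EuclideanSpace ℂ (Fin n) => z k) (hp.right_eq_flow hγ)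
      simp only [flow, ← hu] at h3
      rw [sub_one_mul, ← h3, dist_eq_norm]
      exact PiLp.norm_apply_le (γ b - γ a) k
    rw [norm_mul] at h2
    have h3 : m ≤ ‖γ a k‖ :=
      (hp.le_re hγ hm (Set.left_mem_Icc.2 hp.lt.le)).trans (Complex.re_le_norm _)
    nlinarith [norm_nonneg (u - 1)]
  choose ℓ hℓ h using key
  have hev : ∀ᶠ r in 𝓝[>] (0 : ℝ), ∀ k, r < ℓ k := eventually_all.2 fun k =>
    nhdsWithin_le_nhds (Iio_mem_nhds (hℓ k))
  obtain ⟨r, hr, hr0⟩ := (hev.and self_mem_nhdsWithin).exists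
  exact ⟨r, hr0, fun k a b hp ha hb => (hr k).le.trans (h k a b hp ha hb)⟩

end IsPassage

namespace IsOrbit

lemma exists_forall_mem_region (hγ : S.IsOrbit γ) {t : Set ℝ} (ht : IsPreconnected t)
    (hne : t.Nonempty) (h : ∀ s ∈ t, ∃ k, γ s ∈ S.region k) :
    ∃ k, ∀ s ∈ t, γ s ∈ S.region k := by
  obtain ⟨s, hs⟩ := hne
  obtain ⟨k, hk⟩ := h s hs
  refine ⟨k, ht.subset_left_of_subset_union (u := γ ⁻¹' S.region k)
    (v := ⋃ l ∈ {l | l ≠ k}, γ ⁻¹' S.region l) ((S.isOpen_region k).preimage hγ.continuous)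
    (isOpen_biUnion fun l _ => (S.isOpen_region l).preimage hγ.continuous) ?_ (fun s hs => ?_)
    ⟨s, hs, hk⟩⟩
  · rw [Set.disjoint_left]
    intro s hs hs'
    obtain ⟨l, hl, hsl⟩ := Set.mem_iUnion₂.1 hs'
    exact (hγ.mem_tube hs).2 l hl hsl
  · obtain ⟨l, hl⟩ := h s hs
    by_cases hlk : l = k
    · exact Or.inl (hlk ▸ hl)
    · exact Or.inr (Set.mem_iUnion₂.2 ⟨l, hlk, hl⟩)

lemma exists_isPassage (hγ : S.IsOrbit γ) {s₀ s s₁ : ℝ} (h0 : ∀ k, γ s₀ ∉ S.region k)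
    (h1 : ∀ k, γ s₁ ∉ S.region k) (hs0 : s₀ ≤ s) (hs1 : s ≤ s₁) (hs : ∃ k, γ s ∈ S.region k) :
    ∃ k a b, IsPassage S γ k a b ∧ s₀ ≤ a ∧ a < s ∧ s < b ∧ b ≤ s₁ := by
  have hc : IsClosed {s | ∀ k, γ s ∉ S.region k} := by
    simp only [Set.ofPred_forall]
    exact isClosed_iInter fun k => ((S.isOpen_region k).preimage hγ.continuous).isClosed_compl
  have hca := isCompact_Icc.inter_left (t := Set.Icc s₀ s) hc
  have hcb := isCompact_Icc.inter_left (t := Set.Icc s s₁) hc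
  have ha := hca.sSup_mem ⟨s₀, h0, le_rfl, hs0⟩
  have hb := hcb.sInf_mem ⟨s₁, h1, hs1, le_rfl⟩
  set a := sSup ({s | ∀ k, γ s ∉ S.region k} ∩ Set.Icc s₀ s) with ha_def
  set b := sInf ({s | ∀ k, γ s ∉ S.region k} ∩ Set.Icc s s₁) with hb_def
  have hne : ∀ t, (∀ k, γ t ∉ S.region k) → t ≠ s := fun t ht hts =>
    hs.elim fun k hk => ht k (hts ▸ hk)
  have has : a < s := ha.2.2.lt_of_ne (hne a ha.1)
  have hsb : s < b := hb.2.1.lt_of_ne (hne b hb.1).symm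
  obtain ⟨k, hk⟩ := hγ.exists_forall_mem_region (isPreconnected_Ioo (a := a) (b := b))
    ⟨s, has, hsb⟩ fun t ht => by
      by_contra! hgood
      rcases le_total t s with hts | hts
      · exact absurd (le_csSup hca.bddAbove ⟨hgood, ha.2.1.trans ht.1.le, hts⟩) (not_le.2 ht.1)
      · exact absurd (csInf_le hcb.bddBelow ⟨hgood, hts, ht.2.le.trans hb.2.2⟩) (not_le.2 ht.2)
  exact ⟨k, a, b, ⟨has.trans hsb, hk, ha.1, hb.1⟩, ha.2.1, has, hsb, hb.2.2⟩

lemma eq_flow_of_forall_notMem (hγ : S.IsOrbit γ) (hab : a ≤ b)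
    (h : ∀ s ∈ Set.Icc a b, ∀ k, γ s ∉ S.region k) : γ b = S.flow (b - a) (γ a) := by
  ext l
  refine eq_exp_mul_of_hasDerivAt (f := fun s => γ s l) (ω := 2 * S.a l) hab fun s hs => ?_
  refine (hasDerivAt_coord (hγ.hasDerivAt s) l).congr_deriv ?_
  rw [PiLp.smul_apply, S.gradient_ham_of_notMem (h s hs), smul_eq_mul]
  push_cast
  ring

/-- Outside of the plugs the orbits are those of the unperturbed flow, up to a change of time. -/
lemma exists_eq_flow (hγ : S.IsOrbit γ) {s₀ s₁ : ℝ} (h0 : ∀ k, γ s₀ ∉ S.region k)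
    (h1 : ∀ k, γ s₁ ∉ S.region k) (h01 : s₀ < s₁) : ∃ θ > 0, γ s₁ = S.flow θ (γ s₀) := by
  obtain ⟨ℓ, hℓ, hpass⟩ := IsPassage.exists_le_sub hγ s₀ s₁
  have short : ∀ x ∈ Set.Icc s₀ s₁, ∀ y ∈ Set.Icc s₀ s₁, (∀ k, γ x ∉ S.region k) →
      (∀ k, γ y ∉ S.region k) → x ≤ y → y - x < ℓ → γ y = S.flow (y - x) (γ x) := by
    intro x hx y hy hgx hgy hxy hlt
    refine hγ.eq_flow_of_forall_notMem hxy fun s hs => ?_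
    by_contra! hbad
    obtain ⟨k, a, b, hp, hxa, has, hsb, hby⟩ := hγ.exists_isPassage hgx hgy hs.1 hs.2 hbad
    linarith [hpass k a b hp ⟨by linarith [hx.1], by linarith [hs.2, hy.2]⟩
      ⟨by linarith [hx.1, hs.1], by linarith [hy.2]⟩]
  have key : ∀ m : ℕ, ∀ s ∈ Set.Icc s₀ s₁, (∀ k, γ s ∉ S.region k) → s - s₀ ≤ m * (ℓ / 2) →
      ∃ θ, 0 ≤ θ ∧ (s₀ < s → 0 < θ) ∧ γ s = S.flow θ (γ s₀) := by
    have hs0 : s₀ ∈ Set.Icc s₀ s₁ := Set.left_mem_Icc.2 h01.le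
    intro m
    induction m with
    | zero =>
      intro s hs hg hle
      have : s = s₀ := le_antisymm (by simpa using hle) hs.1
      subst this
      exact ⟨0, le_rfl, fun h => absurd h (lt_irrefl _), (flow_zero _).symm⟩
    | succ m ih =>
      intro s hs hg hle
      push_cast at hle
      by_cases hsmall : s - ℓ / 2 ≤ s₀
      · exact ⟨s - s₀, sub_nonneg.2 hs.1, sub_pos.2, short s₀ hs0 s hs h0 hg hs.1 (by linarith)⟩
      push Not at hsmall
      have hmem : s - ℓ / 2 ∈ Set.Icc s₀ s₁ := ⟨hsmall.le, by linarith [hs.2]⟩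
      by_cases hgood : ∀ k, γ (s - ℓ / 2) ∉ S.region k
      · obtain ⟨θ, hθ, -, he⟩ := ih _ hmem hgood (by linarith)
        have h2 := short _ hmem s hs hgood hg (by linarith) (by linarith)
        rw [he, flow_flow] at h2
        exact ⟨_, by linarith, fun _ => by linarith, h2⟩
      · push Not at hgood
        obtain ⟨k, a, b, hp, h0a, has, hsb, hb⟩ :=
          hγ.exists_isPassage h0 hg hsmall.le (by linarith) hgood
        have ha' : a ∈ Set.Icc s₀ s₁ := ⟨h0a, by linarith [hs.2]⟩
        have hb' : b ∈ Set.Icc s₀ s₁ := ⟨by linarith, by linarith [hs.2]⟩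
        obtain ⟨θ, hθ, -, he⟩ := ih a ha' hp.left_notMem (by linarith)
        have h2 := short b hb' s hs hp.right_notMem hg hb (by linarith)
        rw [hp.right_eq_flow hγ, he, flow_flow, flow_flow] at h2
        have := S.τ_pos
        exact ⟨_, by linarith, fun _ => by linarith, h2⟩
  obtain ⟨m, hm⟩ := exists_nat_ge ((s₁ - s₀) / (ℓ / 2))
  obtain ⟨θ, -, hθ, he⟩ := key m s₁ (Set.right_mem_Icc.2 h01.le) h1
    ((div_le_iff₀ (half_pos hℓ)).1 hm)
  exact ⟨θ, hθ h01, he⟩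

end IsOrbit

end PlugSystem

namespace PlugSystem

open Filter Topology

variable {n : ℕ} {S : PlugSystem n} {γ : ℝ → EuclideanSpace ℂ (Fin n)} {k : Fin n} {a b : ℝ}

namespace IsOrbit

lemma rate_eq_zero (hγ : S.IsOrbit γ) {T : ℝ} (hT : 0 < T) (hper : Function.Periodic γ T)
    (h : ∀ s, γ s ∈ S.region k) (s : ℝ) : S.rate k (γ s) = 0 := by
  have htube : ∀ s, γ s ∈ S.tube k := fun s => hγ.mem_tube (h s)
  have hmono := hγ.monotoneOn_time (a := s - T / 2) (b := s + T / 2) (fun s _ => htube s)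
    fun s _ => (h s).2.2.le
  have hends : γ (s + T / 2) = γ (s - T / 2) := by
    rw [← hper (s - T / 2)]
    congr 1
    ring
  have hconst : ∀ t ∈ Set.Icc (s - T / 2) (s + T / 2),
      S.time k (γ t) = S.time k (γ (s - T / 2)) := fun t ht => by
    have h1 := hmono (Set.left_mem_Icc.2 (by linarith)) ht ht.1
    have h2 := hmono ht (Set.right_mem_Icc.2 (by linarith)) ht.2
    simp only [hends] at h1 h2
    exact le_antisymm h2 h1
  refine (S.hasDerivAt_time (hγ.hasDerivAt s) (htube s).1 (htube s).2).unique
    ((hasDerivAt_const s (S.time k (γ (s - T / 2)))).congr_of_eventuallyEq ?_)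
  filter_upwards [Icc_mem_nhds (show s - T / 2 < s by linarith) (show s < s + T / 2 by linarith)]
    using hconst

lemma exists_notMem_region (hγ : S.IsOrbit γ) (hn : 3 ≤ n) (hS : PairwiseIncommensurable S.a)
    {T : ℝ} (hT : 0 < T) (hper : Function.Periodic γ T) : ∃ s, ∀ k, γ s ∉ S.region k := by
  by_contra! hbad
  obtain ⟨k, hk⟩ := hγ.exists_forall_mem_region isPreconnected_univ ⟨0, trivial⟩
    fun s _ => hbad s
  replace hk := fun s => hk s trivial
  have htube : ∀ s, γ s ∈ S.tube k := fun s => hγ.mem_tube (hk s)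
  have hcore := fun s => S.profile.core_of_speed_eq_zero _ _ _ _ (S.abs_weighted_le (hk s).2.2.le)
    (hγ.rate_eq_zero hT hper hk s)
  have hact : ∀ l, l ≠ k → ∀ s, S.action k l (γ s) = 0 := fun l hl s => by
    have := S.action_sq_le_sqSum hl (γ s)
    rw [(hcore s).1] at this
    exact pow_eq_zero_iff two_ne_zero |>.1 (le_antisymm this (sq_nonneg _))
  have hA : ∀ s, S.weighted k (γ s) = 0 := fun s =>
    Finset.sum_eq_zero fun j hj => by rw [hact j (Finset.ne_of_mem_erase hj), mul_zero]
  have htime : ∀ s, S.time k (γ s) = S.time k (γ 0) := fun s => by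
    refine is_const_of_deriv_eq_zero (f := fun s => S.time k (γ s)) (fun s => ?_) (fun s => ?_) s 0
    · exact (S.hasDerivAt_time (hγ.hasDerivAt s) (htube s).1 (htube s).2).differentiableAt
    · rw [(S.hasDerivAt_time (hγ.hasDerivAt s) (htube s).1 (htube s).2).deriv,
        hγ.rate_eq_zero hT hper hk]
  set ν := fderiv ℝ S.F (0, 0, S.time k (γ 0), 0) (1, 0, 0, 0) with hν
  have hν0 : ν ≠ 0 := S.profile.fderiv_A_core _ (hcore 0).2.1
  have hspeed : ∀ l, l ≠ k → ∀ s, S.speed k l (γ s) = ν * S.a l := fun l hl s => by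
    rw [speed, hact l hl, dF, coord, hA, (hcore s).1, (hcore s).2.2, htime, hν]
    ring
  have hexp : ∀ l, l ≠ k → Complex.exp (2 * S.a l * (ν * T / 2 : ℝ) * Complex.I) = 1 := by
    intro l hl
    have h1 := eq_exp_mul_of_hasDerivAt (f := fun s => S.rot k l (γ s) - S.c) (ω := ν * S.a l)
      hT.le fun s _ => by
        rw [← hspeed l hl s]
        exact (S.hasDerivAt_rot (hγ.hasDerivAt s) (htube s).1 (htube s).2 hl).sub_const _
    have h2 : S.rot k l (γ 0) - S.c ≠ 0 := by
      intro h0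
      have := S.two_mul_action k l (γ 0)
      rw [hact l hl, h0] at this
      simp [S.c_pos.ne'] at this
    have h3 : γ T = γ 0 := by simpa using hper 0
    simp only [h3] at h1
    refine mul_right_cancel₀ h2 (Eq.trans ?_ (h1.symm.trans (one_mul _).symm))
    congr 2
    push_cast
    ring
  have hcard : 1 < (Finset.univ.erase k).card := by
    rw [Finset.card_erase_of_mem (Finset.mem_univ k), Finset.card_univ, Fintype.card_fin]
    omega
  obtain ⟨j, hj, l, hl, hjl⟩ := Finset.one_lt_card.1 hcard
  have := eq_zero_of_exp_eq_one S.a_pos hS hjl (hexp j (Finset.ne_of_mem_erase hj))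
    (hexp l (Finset.ne_of_mem_erase hl))
  simp [hν0, hT.ne'] at this

lemma exists_forall_ne_eq_zero (hγ : S.IsOrbit γ) (hS : PairwiseIncommensurable S.a)
    {T : ℝ} (hT : 0 < T) (hper : Function.Periodic γ T) {s : ℝ} (hs : ∀ k, γ s ∉ S.region k)
    {j l : Fin n} (hjl : j ≠ l) (hj : γ s j ≠ 0) : γ s l = 0 := by
  by_contra hl
  have hs' : ∀ k, γ (s + T) ∉ S.region k := by rwa [hper s]
  obtain ⟨θ, hθ, he⟩ := hγ.exists_eq_flow hs hs' (by linarith)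
  rw [hper s] at he
  have hone : ∀ l, γ s l ≠ 0 → Complex.exp (2 * S.a l * θ * Complex.I) = 1 := fun l hl => by
    have h1 := congrArg (fun z : EuclideanSpace ℂ (Fin n) => z l) he
    simp only [flow] at h1
    refine mul_right_cancel₀ hl (Eq.trans ?_ (h1.symm.trans (one_mul _).symm))
    push_cast
    rfl
  exact hθ.ne' (eq_zero_of_exp_eq_one S.a_pos hS hjl (hone j hj) (hone l hl))

end IsOrbit

lemma exists_flow_mem_region (S : PlugSystem n) {z : EuclideanSpace ℂ (Fin n)} (hk : z k ≠ 0)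
    (h : ∀ l, l ≠ k → z l = 0) : ∃ θ > 0, S.flow θ z ∈ S.region k := by
  have ha := S.a_pos k
  refine ⟨(2 * Real.pi - (z k).arg) / (2 * S.a k),
    div_pos (by linarith [Complex.arg_le_pi (z k), Real.pi_pos]) (by linarith), ?_⟩
  set w := S.flow ((2 * Real.pi - (z k).arg) / (2 * S.a k)) z with hw
  have hwk : w k = ‖z k‖ := by
    simp only [hw, flow]
    rw [mul_div_cancel₀ _ (by positivity)]
    nth_rewrite 2 [← Complex.norm_mul_exp_arg_mul_I (z k)]
    rw [mul_left_comm, ← Complex.exp_add]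
    push_cast
    rw [sub_mul, sub_add_cancel, Complex.exp_two_pi_mul_I, mul_one]
  have hwl : ∀ l, l ≠ k → w l = 0 := fun l hl => by simp [hw, flow, h l hl]
  have htime : S.time k w = 0 := by
    have := S.two_mul_a_mul_time k w
    rw [hwk, Complex.arg_ofReal_of_nonneg (norm_nonneg _)] at this
    simpa [ha.ne'] using this
  have hN : S.sqSum k w = 0 := Finset.sum_eq_zero fun l hl => by
    simp [action, rot, hwl l (Finset.ne_of_mem_erase hl)]
  refine ⟨?_, ?_, ?_⟩
  · rw [hwk, Complex.ofReal_re]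
    exact norm_pos_iff.2 hk
  · rw [htime, abs_zero]
    exact S.τ_pos
  · rw [hN]
    exact pow_pos S.c_pos 4

theorem not_isOrbit_of_periodic (S : PlugSystem n) (hn : 3 ≤ n) (hS : PairwiseIncommensurable S.a)
    {T : ℝ} (hT : 0 < T) (hper : Function.Periodic γ T) : ¬ S.IsOrbit γ := by
  intro hγ
  obtain ⟨s₀, h0⟩ := hγ.exists_notMem_region hn hS hT hper
  have hz : ∃ k, γ s₀ k ≠ 0 := by
    by_contra! h
    have := S.three_quarters_le_quad (hγ.level s₀)
    simp [quad, h] at this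
    norm_num at this
  obtain ⟨k, hk⟩ := hz
  have hbad : ∃ s ≥ s₀, ∃ k, γ s ∈ S.region k := by
    by_contra! hgood
    obtain ⟨θ, hθ, hmem⟩ := S.exists_flow_mem_region hk fun l hl =>
      hγ.exists_forall_ne_eq_zero hS hT hper h0 hl.symm hk
    have := hγ.eq_flow_of_forall_notMem (a := s₀) (b := s₀ + θ) (by linarith)
      fun s hs => hgood s hs.1
    rw [add_sub_cancel_left] at this
    exact hgood (s₀ + θ) (by linarith) k (this ▸ hmem)
  obtain ⟨s, hs, hsk⟩ := hbad
  obtain ⟨m, hm⟩ := exists_nat_ge ((s - s₀) / T)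
  have h1 : ∀ k, γ (s₀ + m * T) ∉ S.region k := by
    rwa [hper.nat_mul m s₀]
  obtain ⟨k, a, b, hp, -⟩ := hγ.exists_isPassage h0 h1 hs
    (by linarith [(div_le_iff₀ hT).1 hm]) hsk
  obtain ⟨l, hl, hl0⟩ := hp.exists_left_ne_zero hγ
  refine hl0 (hγ.exists_forall_ne_eq_zero hS hT hper hp.left_notMem hl.symm fun h => ?_)
  have := (hp.mem_tube hγ (Set.left_mem_Icc.2 hp.lt.le)).1
  simp [h] at this

end PlugSystem

namespace PlugSystem

open Filter Topology

variable {n : ℕ}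

lemma exists_plugSystem {a : Fin n → ℝ} (ha : ∀ k, 0 < a k) {ε : ℝ} (hε : 0 < ε) :
    ∃ S : PlugSystem n, S.a = a ∧ n * S.δ ≤ ε := by
  set σ := 1 + ∑ k, a k with hσ
  have hsum : 0 ≤ ∑ k, a k := Finset.sum_nonneg fun k _ => (ha k).le
  have hσ0 : 0 < σ := by linarith
  have hδ : 0 < min ε (1 / 4) / (n + 1) := by positivity
  have hτ : 0 < 1 / (2 * σ) := by positivity
  have hc : 0 < 1 / (6 * σ) := by positivity
  have hM : 0 ≤ ∑ k, a k * (1 / (6 * σ)) ^ 2 :=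
    Finset.sum_nonneg fun k _ => mul_nonneg (ha k).le (sq_nonneg _)
  obtain ⟨F, hF⟩ := PlugProfile.exists_isPlugProfile hδ hτ (pow_pos hc 4) hM
  have hnδ : n * (min ε (1 / 4) / (n + 1)) ≤ min ε (1 / 4) := by
    have : 0 < min ε (1 / 4) := by positivity
    rw [mul_div_assoc', div_le_iff₀ (by positivity)]
    nlinarith
  refine ⟨⟨a, _, _, _, _, F, ha, hc, hτ, hδ, fun k => ?_, ?_, le_rfl,
    hnδ.trans (min_le_right _ _), hF⟩, rfl, hnδ.trans (min_le_left _ _)⟩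
  · have := Finset.single_le_sum (fun k _ => (ha k).le) (Finset.mem_univ k)
    rw [mul_one_div, div_le_one (by positivity)]
    linarith
  · rw [← Finset.sum_mul, show ∑ k, a k = σ - 1 by rw [hσ]; ring]
    field_simp
    nlinarith

/-- The diagonal quadratic form with coefficients `a`. -/
noncomputable def diag (a : Fin n → ℝ) (z : EuclideanSpace ℂ (Fin n)) : ℝ := ∑ k, a k * ‖z k‖ ^ 2

lemma contDiff_diag (a : Fin n → ℝ) : ContDiff ℝ (⊤ : ℕ∞) (diag a) :=
  ContDiff.sum fun l _ => contDiff_const.mul ((contDiff_coord l).norm_sq ℝ)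

lemma isCompact_diag_le {a : Fin n → ℝ} (ha : ∀ k, 0 < a k) (R : ℝ) :
    IsCompact {z | diag a z ≤ R} := by
  refine Metric.isCompact_of_isClosed_isBounded
    (isClosed_le (contDiff_diag a).continuous continuous_const)
    (isBounded_iff_forall_norm_le.2 ⟨√(∑ k, R / a k), fun z hz => Real.le_sqrt_of_sq_le ?_⟩)
  rw [EuclideanSpace.norm_sq_eq]
  refine Finset.sum_le_sum fun k _ => ?_
  rw [le_div_iff₀' (ha k)]
  exact (Finset.single_le_sum (f := fun k => a k * ‖z k‖ ^ 2)
    (fun k _ => mul_nonneg (ha k).le (sq_nonneg _)) (Finset.mem_univ k)).trans hz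

/-- The perturbed Hamiltonian, cut off to the diagonal form with coefficients `a` at infinity. -/
noncomputable def cutoffHam (S : PlugSystem n) (a : Fin n → ℝ) (z : EuclideanSpace ℂ (Fin n)) : ℝ :=
  diag a z + Real.smoothTransition (3 - diag a z) * (S.quad z - diag a z) + ∑ k, S.plug k z

lemma contDiff_cutoffHam (S : PlugSystem n) (a : Fin n → ℝ) :
    ContDiff ℝ (⊤ : ℕ∞) (S.cutoffHam a) :=
  ((contDiff_diag a).add (((Real.smoothTransition.contDiff (n := (⊤ : ℕ∞))).comp
    (contDiff_const.sub (contDiff_diag a))).mul (S.contDiff_quad.sub (contDiff_diag a)))).add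
    (ContDiff.sum fun k _ => S.contDiff_plug k)

lemma diag_le_quad {S : PlugSystem n} {a : Fin n → ℝ} (h : ∀ k, a k ≤ S.a k)
    (z : EuclideanSpace ℂ (Fin n)) : diag a z ≤ S.quad z :=
  Finset.sum_le_sum fun k _ => mul_le_mul_of_nonneg_right (h k) (sq_nonneg _)

lemma quad_le_diag {S : PlugSystem n} {a : Fin n → ℝ} {η : ℝ} (h : ∀ k, S.a k ≤ (1 + η) * a k)
    (z : EuclideanSpace ℂ (Fin n)) : S.quad z ≤ (1 + η) * diag a z := by
  rw [diag, Finset.mul_sum]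
  refine Finset.sum_le_sum fun k _ => ?_
  rw [← mul_assoc]
  exact mul_le_mul_of_nonneg_right (h k) (sq_nonneg _)

lemma plug_eq_zero_of_two_le {S : PlugSystem n} {a : Fin n → ℝ} (h : ∀ k, a k ≤ S.a k)
    {z : EuclideanSpace ℂ (Fin n)} (hz : 2 ≤ diag a z) (k : Fin n) : S.plug k z = 0 := by
  by_contra h0
  linarith [(abs_le.1 (S.of_plug_ne_zero h0).2.2.2).2, S.δ_le k, diag_le_quad h z]

lemma cutoffHam_eq_diag {S : PlugSystem n} {a : Fin n → ℝ} (h : ∀ k, a k ≤ S.a k)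
    {z : EuclideanSpace ℂ (Fin n)} (hz : 3 ≤ diag a z) : S.cutoffHam a z = diag a z := by
  rw [cutoffHam, Real.smoothTransition.zero_of_nonpos (by linarith),
    Finset.sum_eq_zero fun k _ => plug_eq_zero_of_two_le h (by linarith) k]
  ring

lemma abs_cutoffHam_sub_diag_le {S : PlugSystem n} {a : Fin n → ℝ} {η : ℝ} (hη : 0 ≤ η)
    (h : ∀ k, a k ≤ S.a k) (h' : ∀ k, S.a k ≤ (1 + η) * a k) (z : EuclideanSpace ℂ (Fin n)) :
    |S.cutoffHam a z - diag a z| ≤ 3 * η + n * S.δ := by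
  have hplug : |∑ k, S.plug k z| ≤ n * S.δ := by
    have := S.abs_ham_sub_quad_le z
    rwa [ham, add_sub_cancel_left] at this
  have h0 := diag_le_quad h z
  have h1 : |Real.smoothTransition (3 - diag a z) * (S.quad z - diag a z)| ≤ 3 * η := by
    rcases le_total 3 (diag a z) with h3 | h3
    · rw [Real.smoothTransition.zero_of_nonpos (by linarith), zero_mul, abs_zero]
      positivity
    · rw [abs_of_nonneg (mul_nonneg (Real.smoothTransition.nonneg _) (by linarith))]
      have h2 := quad_le_diag h' z
      have h4 := Real.smoothTransition.le_one (3 - diag a z)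
      nlinarith
  calc |S.cutoffHam a z - diag a z| =
        |Real.smoothTransition (3 - diag a z) * (S.quad z - diag a z) + ∑ k, S.plug k z| := by
          rw [cutoffHam]
          congr 1
          ring
    _ ≤ _ := (abs_add_le _ _).trans (add_le_add h1 hplug)

lemma cutoffHam_eventuallyEq {S : PlugSystem n} {a : Fin n → ℝ} (h : ∀ k, a k ≤ S.a k)
    {z : EuclideanSpace ℂ (Fin n)} (hz : S.cutoffHam a z = 1) : S.cutoffHam a =ᶠ[𝓝 z] S.ham := by
  have hlt : diag a z < 2 := by
    by_contra! h2
    rw [cutoffHam, Finset.sum_eq_zero fun k _ => plug_eq_zero_of_two_le h h2 k] at hz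
    have := mul_nonneg (Real.smoothTransition.nonneg (3 - diag a z))
      (sub_nonneg.2 (diag_le_quad h z))
    linarith
  filter_upwards [(contDiff_diag a).continuous.continuousAt.eventually_lt continuousAt_const hlt]
    with w hw
  rw [cutoffHam, ham, Real.smoothTransition.one_of_one_le (by linarith)]
  ring

end PlugSystem

/-- A diagonal Hamiltonian admits a perturbation without periodic orbits on the level `1`. -/
theorem exists_perturbation_of_diag {n : ℕ} (hn : 3 ≤ n) {a : Fin n → ℝ} (ha : ∀ k, 0 < a k)
    {ε : ℝ} (hε : 0 < ε) : ∃ h : EuclideanSpace ℂ (Fin n) → ℝ, ContDiff ℝ (⊤ : ℕ∞) h ∧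
      (∃ K, IsCompact K ∧ ∀ z ∉ K, h z = PlugSystem.diag a z) ∧
      (∀ z, |h z - PlugSystem.diag a z| ≤ ε) ∧
      (∀ z, h z = 1 → gradient h z ≠ 0) ∧
      ∀ γ : ℝ → EuclideanSpace ℂ (Fin n),
        (∀ t, HasDerivAt γ (Complex.I • gradient h (γ t)) t) → (∀ t, h (γ t) = 1) →
        ∀ T > 0, ¬ Function.Periodic γ T := by
  obtain ⟨b, hab, hba, hb⟩ := exists_pairwiseIncommensurable a ha (η := ε / 6) (by linarith)
  obtain ⟨S, rfl, hδ⟩ := PlugSystem.exists_plugSystem (fun k => (ha k).trans_le (hab k))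
    (half_pos hε)
  refine ⟨S.cutoffHam a, S.contDiff_cutoffHam a, ⟨_, PlugSystem.isCompact_diag_le ha 3,
    fun z hz => PlugSystem.cutoffHam_eq_diag hab (not_le.1 hz).le⟩, fun z => ?_, fun z hz => ?_,
    fun γ hγ hlevel T hT hper => ?_⟩
  · linarith [PlugSystem.abs_cutoffHam_sub_diag_le (by linarith : (0 : ℝ) ≤ ε / 6) hab hba z]
  · have he := PlugSystem.cutoffHam_eventuallyEq hab hz
    rw [he.gradient_eq]
    exact S.gradient_ham_ne_zero (he.eq_of_nhds ▸ hz) (by omega)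
  · have he := fun t => PlugSystem.cutoffHam_eventuallyEq hab (hlevel t)
    refine S.not_isOrbit_of_periodic hn hb hT hper ⟨fun t => ?_, fun t => ?_⟩
    · rw [← (he t).gradient_eq]
      exact hγ t
    · rw [← (he t).eq_of_nhds, hlevel t]

lemma gradient_eq_zero_iff {E : Type*} [NormedAddCommGroup E] [InnerProductSpace ℝ E]
    [CompleteSpace E] {f : E → ℝ} {x : E} : gradient f x = 0 ↔ fderiv ℝ f x = 0 := by
  simp [gradient]

lemma hasDerivAt_symm_of_symplectic {n : ℕ}
    {L : EuclideanSpace ℂ (Fin n) ≃L[ℝ] EuclideanSpace ℂ (Fin n)}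
    (hL : ∀ u v, ⟪Complex.I • L u, L v⟫ = ⟪Complex.I • u, v⟫)
    {h : EuclideanSpace ℂ (Fin n) → ℝ} (hh : Differentiable ℝ h)
    {γ : ℝ → EuclideanSpace ℂ (Fin n)} {t : ℝ}
    (hγ : HasDerivAt γ (Complex.I • gradient (h ∘ L.symm) (γ t)) t) :
    HasDerivAt (fun t => L.symm (γ t)) (Complex.I • gradient h (L.symm (γ t))) t := by
  refine (L.symm.hasFDerivAt.comp_hasDerivAt t hγ).congr_deriv ?_
  have hI : ∀ u : EuclideanSpace ℂ (Fin n), Complex.I • Complex.I • u = -u := fun u => by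
    rw [smul_smul, Complex.I_mul_I, neg_one_smul]
  have key : Complex.I • L.symm (Complex.I • gradient (h ∘ L.symm) (γ t)) =
      -gradient h (L.symm (γ t)) := by
    refine ext_inner_right ℝ fun v => ?_
    rw [← hL, L.apply_symm_apply, hI, inner_neg_left, inner_neg_left, inner_gradient_left,
      inner_gradient_left, ((hh _).hasFDerivAt.comp (γ t) L.symm.hasFDerivAt).fderiv]
    simp
  have := congrArg (fun u => -(Complex.I • u)) key
  simpa [hI] using this

/-- **Hamiltonian Seifert conjecture counterexample as a function** (`2n ≥ 6`): for any
positive definite quadratic form `Q` on `ℝ^{2n} = ℂ^n` and any `ε > 0` there is a smooth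
function `h` agreeing with `Q` outside a compact set, `ε`-close to `Q`, having `1` as a
regular value, whose Hamiltonian flow `γ' = i∇h(γ)` has no closed trajectory on
`{h = 1}`. -/
theorem hamiltonian_seifert_counterexample_function (n : ℕ) (hn : 3 ≤ n)
    (Q : QuadraticForm ℝ (EuclideanSpace ℂ (Fin n))) (hQ : Q.PosDef)
    (ε : ℝ) (hε : 0 < ε) :
    ∃ h : EuclideanSpace ℂ (Fin n) → ℝ,
      ContDiff ℝ (⊤ : ℕ∞) h ∧
      (∃ K : Set (EuclideanSpace ℂ (Fin n)), IsCompact K ∧ ∀ x ∉ K, h x = Q x) ∧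
      (∀ x, |h x - Q x| ≤ ε) ∧
      (∀ x, h x = 1 → gradient h x ≠ 0) ∧
      ¬ ∃ γ : ℝ → EuclideanSpace ℂ (Fin n),
          (∀ t, HasDerivAt γ
            ((Complex.I • gradient h (γ t) : EuclideanSpace ℂ (Fin n))) t) ∧
          (∀ t, h (γ t) = 1) ∧
          (∃ T > 0, ∀ t, γ (t + T) = γ t) ∧
          (∃ t s, γ t ≠ γ s) := by
  obtain ⟨L, a, ha, hL, hQL⟩ := exists_symplectic_diagonalization hQ
  obtain ⟨h, hsmooth, ⟨K, hK, hKeq⟩, hε, hreg, horb⟩ := exists_perturbation_of_diag hn ha hε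
  have hQd : ∀ x, PlugSystem.diag a (L.symm x) = Q x := fun x => by
    rw [PlugSystem.diag, ← hQL, L.apply_symm_apply]
  refine ⟨h ∘ L.symm, hsmooth.comp L.symm.contDiff, ⟨L '' K, hK.image L.continuous,
    fun x hx => ?_⟩, fun x => ?_, fun x hx h0 => ?_, ?_⟩
  · rw [← hQd]
    exact hKeq _ fun hx' => hx ⟨_, hx', L.apply_symm_apply x⟩
  · rw [← hQd]
    exact hε _
  · refine hreg _ hx ?_
    rw [gradient_eq_zero_iff] at h0 ⊢
    have hd := ((hsmooth.differentiable (by simp) (L.symm x)).hasFDerivAt.comp x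
      L.symm.hasFDerivAt).fderiv
    rw [h0] at hd
    ext v
    have := congrArg (fun D => D (L v)) hd
    simpa using this.symm
  · rintro ⟨γ, hγ, hlevel, ⟨T, hT, hper⟩, -⟩
    refine horb (fun t => L.symm (γ t)) (fun t => hasDerivAt_symm_of_symplectic hL
      (hsmooth.differentiable (by simp)) (hγ t)) hlevel T hT fun t => ?_
    simp only [hper t]
end

section
/- For every integer n ≥ 2 there exist an invertible antisymmetric real 2n×2n matrix Ω and a C^∞ function H : ℝ^{2n} → ℝ with H(x + k) = H(x) for all k ∈ ℤ^{2n}, such that for every c ∈ (1/2, 3/2): c is a regular value of H, and the Hamiltonian flow of H on the torus ℝ^{2n}/ℤ^{2n} with respect to the constant symplectic form determined by Ω has no periodic orbits of energy c; that is, there is no nonconstant solution γ : ℝ → ℝ^{2n} of γ'(t) = Ω^{-1}∇H(γ(t)) with H(γ(0)) = c for which there exists T > 0 with γ(t+T) − γ(t) ∈ ℤ^{2n} for all t. (Zehnder's torus example.) -/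
/-- The gradient of a function of a single coordinate. -/
theorem hasGradientAt_comp_coord {ι : Type*} [Fintype ι] [DecidableEq ι] {h : ℝ → ℝ} {h' : ℝ}
    {x : EuclideanSpace ℝ ι} {p : ι} (hh : HasDerivAt h h' (x p)) :
    HasGradientAt (fun y : EuclideanSpace ℝ ι => h (y p)) (EuclideanSpace.single p h') x := by
  rw [hasGradientAt_iff_hasFDerivAt]
  have hp : HasFDerivAt (fun y : EuclideanSpace ℝ ι => y p)
      (EuclideanSpace.proj p : EuclideanSpace ℝ ι →L[ℝ] ℝ) x :=
    (EuclideanSpace.proj p : EuclideanSpace ℝ ι →L[ℝ] ℝ).hasFDerivAt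
  refine (hh.comp_hasFDerivAt x hp).congr_fderiv ?_
  ext v
  simp [EuclideanSpace.inner_single_left]

/-- A function on `ℝ` with constant derivative is affine. -/
theorem eq_add_mul_of_hasDerivAt_const {f : ℝ → ℝ} {a : ℝ} (hf : ∀ t, HasDerivAt f a t) (t : ℝ) :
    f t = f 0 + a * t := by
  have hd : ∀ s, HasDerivAt (fun s => f s - a * s) 0 s := fun s => by
    simpa using (hf s).fun_sub ((hasDerivAt_id s).const_mul a)
  have h := is_const_of_deriv_eq_zero (fun s => (hd s).differentiableAt) (fun s => (hd s).deriv) t 0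
  simp only [mul_zero, sub_zero] at h
  linarith

/-- For `n ≥ 2` there is an invertible antisymmetric matrix of size `2n` having a column with
two entries `1` and `√2`. -/
theorem exists_isUnit_antisymm_col_one_sqrt_two {n : ℕ} (hn : 2 ≤ n) :
    ∃ (A : Matrix (Fin (2 * n)) (Fin (2 * n)) ℝ) (p q r : Fin (2 * n)),
      IsUnit A ∧ A.transpose = -A ∧ A q p = 1 ∧ A r p = √2 := by
  let e : Fin n ⊕ Fin n ≃ Fin (2 * n) := finSumFinEquiv.trans (finCongr (two_mul n).symm)
  let i : Fin n := ⟨0, by omega⟩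
  let j : Fin n := ⟨1, by omega⟩
  have hij : i ≠ j := by simp [i, j]
  let S : Matrix (Fin n ⊕ Fin n) (Fin n ⊕ Fin n) ℝ :=
    Matrix.transvection (Sum.inl j) (Sum.inr i) √2
  let A : Matrix (Fin n ⊕ Fin n) (Fin n ⊕ Fin n) ℝ := S * Matrix.J (Fin n) ℝ * S.transpose
  have hS : S.det = 1 := Matrix.det_transvection_of_ne _ _ (by simp) _
  have hA : IsUnit A := by
    rw [Matrix.isUnit_iff_isUnit_det]
    simpa [A, hS] using Matrix.isUnit_det_J (Fin n) ℝ
  have hAt : A.transpose = -A := by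
    simp [A, Matrix.transpose_mul, Matrix.J_transpose, Matrix.mul_assoc]
  have hcol : ∀ k, A k (Sum.inl i) = (S * Matrix.J (Fin n) ℝ) k (Sum.inl i) := fun k => by
    simp [A, S, Matrix.transvection, Matrix.mul_add, Matrix.transpose_single, hij]
  refine ⟨A.submatrix e.symm e.symm, e (Sum.inl i), e (Sum.inr i), e (Sum.inl j), ?_, ?_, ?_, ?_⟩
  · exact (Matrix.isUnit_submatrix_equiv e.symm e.symm).2 hA
  · rw [Matrix.transpose_submatrix, hAt]; rfl
  · simp [hcol, S, Matrix.transvection, Matrix.add_mul, Matrix.J]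
  · simp [hcol, S, Matrix.transvection, Matrix.add_mul, Matrix.J]

/-- If `a` and `√2 * a` are both integers then `a = 0`. -/
theorem eq_zero_of_eq_intCast_of_sqrt_two_mul_eq_intCast {a : ℝ} {k l : ℤ} (hk : a = k)
    (hl : √2 * a = l) : a = 0 := by
  by_contra ha
  refine irrational_sqrt_two ⟨(l : ℚ) / k, ?_⟩
  push_cast
  rw [← hk, ← hl, mul_div_assoc, div_self ha, mul_one]

/-- **Zehnder's torus example**: for `2n ≥ 4` there is an irrational
translation-invariant symplectic structure `Ω` on `𝕋^{2n}` and a smooth `ℤ^{2n}`-periodic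
Hamiltonian `H` such that every `c ∈ (1/2, 3/2)` is a regular value of `H` and the
Hamiltonian flow `γ' = Ω⁻¹∇H(γ)` has no nonconstant periodic orbit of energy `c` on the
torus `ℝ^{2n}/ℤ^{2n}`. -/
theorem zehnder_torus (n : ℕ) (hn : 2 ≤ n) :
    ∃ (Ω : Matrix (Fin (2 * n)) (Fin (2 * n)) ℝ)
      (H : EuclideanSpace ℝ (Fin (2 * n)) → ℝ),
      IsUnit Ω ∧ Matrix.transpose Ω = -Ω ∧ ContDiff ℝ (⊤ : ℕ∞) H ∧
      (∀ (x : EuclideanSpace ℝ (Fin (2 * n))) (k : Fin (2 * n) → ℤ),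
        H (x + (WithLp.equiv 2 (Fin (2 * n) → ℝ)).symm (fun i => (k i : ℝ))) = H x) ∧
      ∀ c ∈ Set.Ioo (1 / 2 : ℝ) (3 / 2),
        (∀ x, H x = c → gradient H x ≠ 0) ∧
        ¬ ∃ γ : ℝ → EuclideanSpace ℝ (Fin (2 * n)),
            (∀ t, HasDerivAt γ (Matrix.toEuclideanLin Ω⁻¹ (gradient H (γ t))) t) ∧
            H (γ 0) = c ∧
            (∃ t s, γ t ≠ γ s) ∧
            (∃ T > 0, ∀ t, ∃ k : Fin (2 * n) → ℤ,
              γ (t + T) = γ t +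
                (WithLp.equiv 2 (Fin (2 * n) → ℝ)).symm (fun i => (k i : ℝ))) := by
  obtain ⟨A, p, q, r, hA, hAt, hq, hr⟩ := exists_isUnit_antisymm_col_one_sqrt_two hn
  have hdet : IsUnit A.det := (Matrix.isUnit_iff_isUnit_det A).1 hA
  have hp : A p p = 0 := by
    have := congrFun (congrFun hAt p) p
    simp only [Matrix.transpose_apply, Matrix.neg_apply] at this
    linarith
  let h : ℝ → ℝ := fun s => 1 + Real.sin (s * (2 * Real.pi))
  let h' : ℝ → ℝ := fun s => Real.cos (s * (2 * Real.pi)) * (2 * Real.pi)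
  have hh : ∀ s, HasDerivAt h (h' s) s := fun s => by
    simpa [h, h'] using (((hasDerivAt_id s).mul_const (2 * Real.pi)).sin).const_add 1
  have hgrad : ∀ x : EuclideanSpace ℝ (Fin (2 * n)),
      gradient (fun y : EuclideanSpace ℝ (Fin (2 * n)) => h (y p)) x =
        EuclideanSpace.single p (h' (x p)) :=
    fun x => (hasGradientAt_comp_coord (hh (x p))).gradient
  have hreg : ∀ c ∈ Set.Ioo (1 / 2 : ℝ) (3 / 2), ∀ s, h s = c → h' s ≠ 0 := by
    rintro c ⟨hc1, hc2⟩ s rfl h0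
    have hcos : Real.cos (s * (2 * Real.pi)) = 0 := by simpa [h', Real.pi_ne_zero] using h0
    have := Real.sin_sq_add_cos_sq (s * (2 * Real.pi))
    simp only [h] at hc1 hc2
    nlinarith
  refine ⟨A⁻¹, fun x => h (x p), (Matrix.isUnit_nonsing_inv_iff).2 hA, ?_, ?_, ?_, ?_⟩
  · rw [Matrix.transpose_nonsing_inv, hAt]
    exact Matrix.inv_eq_left_inv (by simp [Matrix.nonsing_inv_mul A hdet])
  · simp only [h]
    fun_prop
  · intro x k
    simp [h, add_mul, Real.sin_add_int_mul_two_pi]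
  · intro c hc
    refine ⟨fun x hx => ?_, ?_⟩
    · rw [hgrad]
      simpa using hreg c hc _ hx
    · rintro ⟨γ, hγ, h0, -, T, hT, hper⟩
      have hcoord : ∀ i t, HasDerivAt (fun t => γ t i) (A i p * h' (γ t p)) t := fun i t => by
        have := (EuclideanSpace.proj i :
          EuclideanSpace ℝ (Fin (2 * n)) →L[ℝ] ℝ).hasFDerivAt.comp_hasDerivAt t (hγ t)
        rw [hgrad, Matrix.nonsing_inv_nonsing_inv A hdet] at this
        simpa [Function.comp_def, Matrix.toLpLin_apply, Matrix.mulVec_single, mul_comm] using this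
      have hconst : ∀ t, γ t p = γ 0 p := fun t => by
        simpa using eq_add_mul_of_hasDerivAt_const (f := fun t => γ t p) (a := 0)
          (fun s => by simpa [hp] using hcoord p s) t
      have hlin : ∀ i, γ T i = γ 0 i + A i p * h' (γ 0 p) * T := fun i =>
        eq_add_mul_of_hasDerivAt_const (f := fun t => γ t i)
          (fun s => by simpa [hconst s] using hcoord i s) T
      obtain ⟨k, hk⟩ := hper 0
      have hint : ∀ i, A i p * h' (γ 0 p) * T = k i := fun i => by
        have := congrArg (fun v : EuclideanSpace ℝ (Fin (2 * n)) => v i) hk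
        simp only [zero_add, hlin i] at this
        simpa using this
      have := eq_zero_of_eq_intCast_of_sqrt_two_mul_eq_intCast
        (a := h' (γ 0 p) * T) (by simpa [hq] using hint q) (by simpa [hr, mul_assoc] using hint r)
      exact mul_ne_zero (hreg c hc _ h0) hT.ne' this
end
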